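/- Let d ≥ 2, α ∈ (0,1), and let μ be a nondegenerate α-stable distribution on ℝ^d with no shift and characteristic exponent Φ_μ(z) = |z|^α V(u_z). If X ∼ μ, then the random variable |X| has probability density function g_{|X|}(r) = Σ_{k=1}^∞ ((−2^α)^k π^{−d/2} / (k! r^{kα+1})) (Γ((kα+d)/2) / Γ(−kα/2)) ∫_{S^{d−1}} V^k dω, for r > 0. -/

import Mathlib

open MeasureTheory Real Filter Topology
open scoped RealInnerProductSpace ENNReal NNReal

noncomputable section

namespace StablePaper

abbrev Ed (d : ℕ) : Type := EuclideanSpace ℝ (Fin d)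

abbrev Sph (d : ℕ) := Metric.sphere (0 : Ed d) 1

/-- The surface measure `ω` on the unit sphere `S^{d-1}`. -/
def ωd (d : ℕ) : Measure (Sph d) := (volume : Measure (Ed d)).toSphere

/-- `u_z = z/|z|` for `z ≠ 0`, as a point of the unit sphere. -/
def unitize {d : ℕ} (z : Ed d) (hz : z ≠ 0) : Sph d :=
  ⟨‖z‖⁻¹ • z, by
    rw [mem_sphere_iff_norm, sub_zero, norm_smul, norm_inv, norm_norm,
      inv_mul_cancel₀ (norm_ne_zero_iff.mpr hz)]⟩

/-- Negation on the unit sphere. -/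
def negS {d : ℕ} (u : Sph d) : Sph d :=
  ⟨-(u : Ed d), by
    rw [mem_sphere_iff_norm, sub_zero, norm_neg]
    have := u.2
    rwa [mem_sphere_iff_norm, sub_zero] at this⟩

/-- Rising factorial (Pochhammer symbol) `(b)_n`. -/
def risingFactorial (b : ℝ) (n : ℕ) : ℝ := ∏ i ∈ Finset.range n, (b + i)

/-- The Gegenbauer polynomial `C_j^b(t)` (for `b > 0`), via its explicit sum formula. -/
def gegenbauer (b : ℝ) (j : ℕ) (t : ℝ) : ℝ :=
  ∑ m ∈ Finset.range (j / 2 + 1),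
    (-1 : ℝ) ^ m * 2 ^ (j - 2 * m) * risingFactorial b (j - m) /
      ((Nat.factorial m : ℝ) * (Nat.factorial (j - 2 * m) : ℝ)) * t ^ (j - 2 * m)

/-- The normalized (ultraspherical) polynomial `C̃_j^b(t) = C_j^b(t)/C_j^b(1)`;
for `b = 0` it is the Chebyshev polynomial `T_j`. -/
def gegenbauerN (b : ℝ) (j : ℕ) (t : ℝ) : ℝ :=
  if b = 0 then (Polynomial.Chebyshev.T ℝ (j : ℤ)).eval t
  else gegenbauer b j t / gegenbauer b j 1

/-- `c_{j,d} = dim ℋ_{j,d}`. -/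
def cdim (d j : ℕ) : ℕ :=
  if j = 0 then 1 else Nat.choose (j + d - 2) j + Nat.choose (j + d - 3) (j - 1)

/-- The surface area `A(S^{d-1}) = 2 π^{d/2} / Γ(d/2)`. -/
def sphereArea (d : ℕ) : ℝ := 2 * Real.pi ^ ((d : ℝ) / 2) / Real.Gamma ((d : ℝ) / 2)

/-- Projection onto spherical harmonics of degree `j` (real-valued version):
`(proj_j f)(u) = (c_{j,d}/A(S^{d-1})) ∫ C̃_j^{(d-2)/2}(⟨u,v⟩) f(v) ω(dv)`. -/
def projR (d j : ℕ) (f : Sph d → ℝ) (u : Sph d) : ℝ :=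
  (cdim d j : ℝ) / sphereArea d *
    ∫ v, gegenbauerN (((d : ℝ) - 2) / 2) j ⟪(u : Ed d), (v : Ed d)⟫ * f v ∂(ωd d)

/-- Projection onto spherical harmonics of degree `j` (complex-valued version). -/
def projC (d j : ℕ) (f : Sph d → ℂ) (u : Sph d) : ℂ :=
  ((cdim d j : ℂ) / (sphereArea d : ℂ)) *
    ∫ v, (gegenbauerN (((d : ℝ) - 2) / 2) j ⟪(u : Ed d), (v : Ed d)⟫ : ℂ) * f v ∂(ωd d)

/-- The coefficients `w_j(α)`. -/
def w (d : ℕ) (α : ℝ) (j : ℕ) : ℝ :=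
  Real.pi ^ ((d : ℝ) / 2) * Real.Gamma (α + 1) /
    (2 ^ (α - 1) * Real.Gamma (((j : ℝ) + α + d) / 2) * Real.Gamma ((α - j) / 2 + 1))

/-- The characteristic exponent of an `α`-stable distribution (`α ≠ 1`) with
spectral spherical measure `Λ`. -/
def charExp (d : ℕ) (α : ℝ) (Λ : Measure (Sph d)) (z : Ed d) : ℂ :=
  ∫ v, (|⟪z, (v : Ed d)⟫| ^ α : ℝ) *
      (1 - Complex.I * (Real.tan (Real.pi * α / 2) : ℂ) *
        (Real.sign ⟪z, (v : Ed d)⟫ : ℂ)) ∂Λ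

/-- `V(u)`, so that `Φ_μ(z) = |z|^α V(u_z)`. -/
def Vfun (d : ℕ) (α : ℝ) (Λ : Measure (Sph d)) (u : Sph d) : ℂ :=
  charExp d α Λ (u : Ed d)

/-- The characteristic exponent of a `1`-stable distribution with
spectral spherical measure `Λ`. -/
def charExp1 (d : ℕ) (Λ : Measure (Sph d)) (z : Ed d) : ℂ :=
  ∫ v, ((|⟪z, (v : Ed d)⟫| : ℝ) : ℂ) +
      Complex.I * ((2 / Real.pi * (⟪z, (v : Ed d)⟫ *
        Real.log |⟪z, (v : Ed d)⟫|) : ℝ) : ℂ) ∂Λ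

/-- The spectral spherical measure `λ(dv) = P(v) ω(dv)`. -/
def specMeasure (d : ℕ) (P : Sph d → ℝ) : Measure (Sph d) :=
  (ωd d).withDensity (fun v => ENNReal.ofReal (P v))

/-- `μ` has Fourier transform `exp (-Φ)` where `Φ` is the `α`-stable characteristic
exponent with spectral spherical measure `Λ` (case `α ≠ 1`). -/
def IsStableChar (d : ℕ) (α : ℝ) (Λ : Measure (Sph d)) (μ : Measure (Ed d)) : Prop :=
  ∀ z : Ed d, ∫ x, Complex.exp (Complex.I * (⟪z, x⟫ : ℂ)) ∂μ =
    Complex.exp (- charExp d α Λ z)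

/-- `μ` has Fourier transform `exp (-Φ)` where `Φ` is the `1`-stable characteristic
exponent with spectral spherical measure `Λ`. -/
def IsStableChar1 (d : ℕ) (Λ : Measure (Sph d)) (μ : Measure (Ed d)) : Prop :=
  ∀ z : Ed d, ∫ x, Complex.exp (Complex.I * (⟪z, x⟫ : ℂ)) ∂μ =
    Complex.exp (- charExp1 d Λ z)

/-- `μ` is nondegenerate: its support is not contained in any proper affine subspace. -/
def Nondegenerate (d : ℕ) (μ : Measure (Ed d)) : Prop :=
  ∀ (a : Ed d) (W : Submodule ℝ (Ed d)), W ≠ ⊤ →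
    μ ((fun x => a + x) '' (W : Set (Ed d))) < 1

/-- `P` is the restriction to the sphere of a polynomial on `ℝ^d`. -/
def IsPolyRestriction (d : ℕ) (P : Sph d → ℝ) : Prop :=
  ∃ p : MvPolynomial (Fin d) ℝ,
    ∀ u : Sph d, P u = MvPolynomial.eval (fun i => (u : Ed d) i) p

/-- `P` is the restriction to the sphere of a polynomial of degree at most `q`. -/
def IsPolyRestrictionDeg (d q : ℕ) (P : Sph d → ℝ) : Prop :=
  ∃ p : MvPolynomial (Fin d) ℝ, p.totalDegree ≤ q ∧
    ∀ u : Sph d, P u = MvPolynomial.eval (fun i => (u : Ed d) i) p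

/-- `f` is a spherical harmonic of degree `j`: the restriction to the sphere of a
homogeneous harmonic polynomial of degree `j`. -/
def IsSphericalHarmonicC (d j : ℕ) (f : Sph d → ℂ) : Prop :=
  ∃ p : MvPolynomial (Fin d) ℂ, p.IsHomogeneous j ∧
    (∑ i : Fin d, MvPolynomial.pderiv i (MvPolynomial.pderiv i p)) = 0 ∧
    ∀ u : Sph d, f u = MvPolynomial.eval (fun i => ((u : Ed d) i : ℂ)) p

/-- `S_{j,k} = (-i)^j proj_j (V^k)`. -/
def SHk (d : ℕ) (α : ℝ) (Λ : Measure (Sph d)) (j k : ℕ) (u : Sph d) : ℂ :=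
  (-Complex.I) ^ j * projC d j (fun v => (Vfun d α Λ v) ^ k) u

/-- `S_{j,p} = (-i)^j proj_j (V^p)` for real exponents `p` (principal branch). -/
def SHp (d : ℕ) (α : ℝ) (Λ : Measure (Sph d)) (j : ℕ) (p : ℝ) (u : Sph d) : ℂ :=
  (-Complex.I) ^ j * projC d j (fun v => (Vfun d α Λ v) ^ (p : ℂ)) u

/-- `g` is the density of the stable distribution with characteristic exponent
`charExp d α Λ`, given by the Fourier inversion formula. -/
def IsDensityOf (d : ℕ) (α : ℝ) (Λ : Measure (Sph d)) (g : Ed d → ℝ) : Prop :=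
  ∀ x : Ed d, (g x : ℂ) =
    (((2 * Real.pi) ^ d)⁻¹ : ℝ) *
      ∫ z : Ed d, Complex.exp (-(Complex.I * (⟪x, z⟫ : ℂ))) *
        Complex.exp (- charExp d α Λ z)

/-- Harmonic numbers `s_n`. -/
def harmonicNum (n : ℕ) : ℝ := ∑ i ∈ Finset.range n, (1 : ℝ) / (i + 1)

def betaD (d : ℕ) : ℝ :=
  if Even d then 1 - Real.log 2 - harmonicNum (d / 2) / 2
  else 1 - harmonicNum (d + 1) + harmonicNum ((d + 1) / 2) / 2

/-- The coefficients `w*_j` (for odd `j`). -/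
def wstar (d j : ℕ) : ℝ :=
  if j = 1 then Real.pi ^ ((d : ℝ) / 2) * betaD d / Real.Gamma ((d : ℝ) / 2 + 1)
  else (-1 : ℝ) ^ ((j - 3) / 2) * Real.pi ^ ((d : ℝ) / 2) *
      Real.Gamma (((j : ℝ) - 1) / 2) / (2 * Real.Gamma (((d : ℝ) + 1 + j) / 2))

/-- The Bessel function of the first kind `J_τ`. -/
def besselJ (τ : ℝ) (x : ℝ) : ℝ :=
  ∑' k : ℕ, (-1 : ℝ) ^ k * (x / 2) ^ (2 * (k : ℝ) + τ) /
    ((Nat.factorial k : ℝ) * Real.Gamma ((k : ℝ) + τ + 1))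

/-- The `(j,k)`-term `((-2^α)^k π^{-d/2} / (k! ρ^{kα+d})) (Γ((j+kα+d)/2)/Γ((j-kα)/2)) S_{j,k}(u)`
of the spherical-harmonic series for the density (`α ∈ (0,1)`), at radius `ρ`. -/
def phiTerm (d : ℕ) (α : ℝ) (Λ : Measure (Sph d)) (j k : ℕ) (ρ : ℝ) (u : Sph d) : ℂ :=
  ((((-((2 : ℝ) ^ α)) ^ k * Real.pi ^ (-(d : ℝ) / 2) /
      ((Nat.factorial k : ℝ) * ρ ^ ((k : ℝ) * α + d)) *
      (Real.Gamma (((j : ℝ) + k * α + d) / 2) /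
        Real.Gamma (((j : ℝ) - k * α) / 2))) : ℝ) : ℂ) * SHk d α Λ j k u

/-- The `k`-th term `((-2^α)^k π^{-d/2} / (k! r^{kα+1})) (Γ((kα+d)/2)/Γ(-kα/2)) ∫ V^k dω`
of the series for the density of `|X|`. -/
def radTerm (d : ℕ) (α : ℝ) (Λ : Measure (Sph d)) (k : ℕ) (r : ℝ) : ℂ :=
  ((((-((2 : ℝ) ^ α)) ^ k * Real.pi ^ (-(d : ℝ) / 2) /
      ((Nat.factorial k : ℝ) * r ^ ((k : ℝ) * α + 1)) *
      (Real.Gamma (((k : ℝ) * α + d) / 2) / Real.Gamma (-((k : ℝ) * α) / 2))) : ℝ) : ℂ) *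
    ∫ u, (Vfun d α Λ u) ^ k ∂(ωd d)

end StablePaper

namespace StablePaper

theorem rpow_self_mul_exp_neg_le_Gamma {s : ℝ} (hs : 0 ≤ s) :
    s ^ s * Real.exp (-s) ≤ Real.Gamma (s + 1) := by
  have hint : IntegrableOn (fun x : ℝ => Real.exp (-x) * x ^ s) (Set.Ioi 0) := by
    simpa using Real.GammaIntegral_convergent (s := s + 1) (by linarith)
  have hsub : Set.Ioi s ⊆ Set.Ioi (0 : ℝ) := Set.Ioi_subset_Ioi hs
  calc s ^ s * Real.exp (-s) = ∫ x in Set.Ioi s, Real.exp (-x) * s ^ s := by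
        rw [integral_mul_const, integral_exp_neg_Ioi, mul_comm]
    _ ≤ ∫ x in Set.Ioi s, Real.exp (-x) * x ^ s := by
        refine setIntegral_mono_on ((integrableOn_exp_neg_Ioi s).mul_const _)
          (hint.mono_set hsub) measurableSet_Ioi fun x hx => ?_
        have : s ≤ x := le_of_lt hx
        gcongr
    _ ≤ ∫ x in Set.Ioi 0, Real.exp (-x) * x ^ s := by
        refine setIntegral_mono_set hint ?_ (Filter.Eventually.of_forall hsub)
        filter_upwards [ae_restrict_mem measurableSet_Ioi] with x hx
        have : (0 : ℝ) < x := hx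
        simp only [Pi.zero_apply]
        positivity
    _ = Real.Gamma (s + 1) := by
        rw [Real.Gamma_eq_integral (by linarith)]; simp

theorem Gamma_add_le_rpow_mul {s b : ℝ} (hs : 0 < s) (hb0 : 0 < b) (hb1 : b < 1) :
    Real.Gamma (s + b) ≤ s ^ b * Real.Gamma s := by
  have h := Real.Gamma_mul_add_mul_le_rpow_Gamma_mul_rpow_Gamma (s := s) (t := s + 1)
    (a := 1 - b) (b := b) hs (by linarith) (by linarith) hb0 (by ring)
  have hG : 0 < Real.Gamma s := Real.Gamma_pos_of_pos hs
  rw [Real.Gamma_add_one hs.ne', Real.mul_rpow hs.le hG.le] at h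
  calc Real.Gamma (s + b) = Real.Gamma ((1 - b) * s + b * (s + 1)) := by congr 1; ring
    _ ≤ _ := h
    _ = s ^ b * (Real.Gamma s ^ (1 - b) * Real.Gamma s ^ b) := by ring
    _ = s ^ b * Real.Gamma s := by
      rw [← Real.rpow_add hG]; simp

/-- The factor by which the `n`-th Post–Widder approximation multiplies `y ^ (-x - 1)`; as
`n → ∞` it tends to `1 / Γ(-x)`. -/
def postWidderCoeff (n : ℕ) (x : ℝ) : ℝ :=
  (n : ℝ) ^ (x + 1) / (Nat.factorial n : ℝ) * ∏ j ∈ Finset.range n, ((j : ℝ) - x)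

theorem tendsto_postWidderCoeff (x : ℝ) :
    Tendsto (fun n => postWidderCoeff n x) atTop (𝓝 (1 / Real.Gamma (-x))) := by
  by_cases hx : Real.Gamma (-x) = 0
  · obtain ⟨m, hm⟩ := (Real.Gamma_eq_zero_iff _).1 hx
    have hxm : x = m := by linarith
    rw [hx, div_zero]
    refine tendsto_const_nhds.congr' ?_
    filter_upwards [eventually_gt_atTop m] with n hn
    rw [postWidderCoeff, Finset.prod_eq_zero (Finset.mem_range.2 hn) (by simp [hxm]), mul_zero]
  · have h1 := (Real.GammaSeq_tendsto_Gamma (-x)).inv₀ hx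
    have h2 : Tendsto (fun n : ℕ => (n : ℝ) / (n - x)) atTop (𝓝 1) := by
      have := tendsto_natCast_div_add_atTop (𝕜 := ℝ) (-x)
      simpa [sub_eq_add_neg] using this
    have h3 := h2.mul h1
    rw [one_mul] at h3
    rw [one_div]
    refine h3.congr' ?_
    filter_upwards [eventually_gt_atTop (max 0 ⌈x⌉₊)] with n hn
    have hn0 : 0 < n := lt_of_le_of_lt (le_max_left _ _) hn
    have hnx : x < n := Nat.lt_of_ceil_lt (lt_of_le_of_lt (le_max_right _ _) hn)
    have hnR : (0 : ℝ) < n := by exact_mod_cast hn0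
    have hd : (n : ℝ) - x ≠ 0 := by linarith
    have hf : (Nat.factorial n : ℝ) ≠ 0 := by exact_mod_cast Nat.factorial_ne_zero n
    rw [Real.GammaSeq, postWidderCoeff, Finset.prod_range_succ, Real.rpow_neg hnR.le,
      Real.rpow_add hnR, Real.rpow_one]
    have hp : ∀ j : ℕ, -x + (j : ℝ) = j - x := fun j => by ring
    simp only [hp]
    have hr : (n : ℝ) ^ x ≠ 0 := (Real.rpow_pos_of_pos hnR x).ne'
    rw [inv_div]
    field_simp

theorem rpow_div_factorial_mul_prod_le {x : ℝ} (hx : 0 ≤ x) (m : ℕ) :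
    ((m : ℝ) + 1) ^ x / (Nat.factorial m : ℝ) * ∏ j ∈ Finset.range m, |(j : ℝ) + 1 - x| ≤
      (x + 1) ^ x * Real.exp x := by
  induction m with
  | zero =>
    simp only [Nat.cast_zero, zero_add, Real.one_rpow, Nat.factorial_zero, Nat.cast_one,
      div_one, Finset.range_zero, Finset.prod_empty, mul_one]
    have h1 : 1 ≤ (x + 1) ^ x := Real.one_le_rpow (by linarith) hx
    have h2 : 1 ≤ Real.exp x := Real.one_le_exp hx
    nlinarith
  | succ m ih =>
    have hf : (0 : ℝ) < Nat.factorial m := by exact_mod_cast Nat.factorial_pos m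
    rcases le_or_gt (((m + 1 : ℕ) : ℝ)) x with hm | hm
    · have hprod : ∏ j ∈ Finset.range (m + 1), |(j : ℝ) + 1 - x| ≤ x ^ (m + 1) := by
        calc ∏ j ∈ Finset.range (m + 1), |(j : ℝ) + 1 - x|
            ≤ ∏ _j ∈ Finset.range (m + 1), x := by
              refine Finset.prod_le_prod (fun _ _ => abs_nonneg _) fun j hj => ?_
              have hj' : (j : ℝ) + 1 ≤ ((m + 1 : ℕ) : ℝ) := by
                exact_mod_cast Finset.mem_range.1 hj
              have hj0 : (0 : ℝ) ≤ j := Nat.cast_nonneg j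
              rw [abs_le]; constructor <;> linarith
          _ = x ^ (m + 1) := by simp
      calc _ ≤ (x + 1) ^ x / (Nat.factorial (m + 1) : ℝ) * x ^ (m + 1) := by gcongr
        _ = (x + 1) ^ x * (x ^ (m + 1) / (Nat.factorial (m + 1) : ℝ)) := by ring
        _ ≤ _ := by
          gcongr
          exact Real.pow_div_factorial_le_exp x hx _
    · refine le_trans ?_ ih
      push_cast at hm ⊢
      have hm0 : (0 : ℝ) < (m : ℝ) + 1 := by positivity
      rw [Finset.prod_range_succ, Nat.factorial_succ, abs_of_pos (by linarith)]
      have key : ((m : ℝ) + 1 + 1) ^ x * (((m : ℝ) + 1 - x) / (m + 1)) ≤ ((m : ℝ) + 1) ^ x := by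
        have e1 : ((m : ℝ) + 1 + 1) ^ x ≤ ((m : ℝ) + 1) ^ x * Real.exp (x / (m + 1)) := by
          have : ((m : ℝ) + 1 + 1) = (m + 1) * (1 / (m + 1) + 1) := by field_simp; ring
          rw [this, Real.mul_rpow hm0.le (by positivity), div_eq_inv_mul x, Real.exp_mul]
          gcongr
          simpa using Real.add_one_le_exp (1 / ((m : ℝ) + 1))
        have e2 : ((m : ℝ) + 1 - x) / (m + 1) ≤ Real.exp (-(x / (m + 1))) := by
          have := Real.add_one_le_exp (-(x / ((m : ℝ) + 1)))
          have h3 : ((m : ℝ) + 1 - x) / (m + 1) = -(x / (m + 1)) + 1 := by field_simp; ring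
          linarith
        calc _ ≤ ((m : ℝ) + 1) ^ x * Real.exp (x / (m + 1)) * Real.exp (-(x / (m + 1))) := by
              gcongr
          _ = _ := by rw [mul_assoc, ← Real.exp_add]; simp
      set p := ∏ j ∈ Finset.range m, |(j : ℝ) + 1 - x| with hp
      have hp0 : 0 ≤ p := Finset.prod_nonneg fun _ _ => abs_nonneg _
      push_cast
      calc _ = ((m : ℝ) + 1 + 1) ^ x * (((m : ℝ) + 1 - x) / (m + 1)) * (p / Nat.factorial m) := by
            field_simp
        _ ≤ ((m : ℝ) + 1) ^ x * (p / Nat.factorial m) := by gcongr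
        _ = _ := by ring

theorem abs_postWidderCoeff_le {x : ℝ} (hx : 0 ≤ x) (n : ℕ) :
    |postWidderCoeff n x| ≤ Real.exp (3 * (x + 1)) * Real.Gamma (x + 2) := by
  have hG : 0 < Real.Gamma (x + 2) := Real.Gamma_pos_of_pos (by linarith)
  rcases n with _ | m
  · rw [postWidderCoeff, Nat.cast_zero, Real.zero_rpow (by linarith)]
    simp only [zero_div, zero_mul, abs_zero]
    positivity
  have hm : (0 : ℝ) < ((m + 1 : ℕ) : ℝ) := by positivity
  have hm' : (0 : ℝ) < (m : ℝ) + 1 := by positivity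
  have hf : (0 : ℝ) < Nat.factorial m := by exact_mod_cast Nat.factorial_pos m
  have h1 : |postWidderCoeff (m + 1) x| = x * (((m : ℝ) + 1) ^ x / (Nat.factorial m : ℝ) *
      ∏ j ∈ Finset.range m, |(j : ℝ) + 1 - x|) := by
    rw [postWidderCoeff, Finset.prod_range_succ', abs_mul, abs_mul, Finset.abs_prod,
      Nat.factorial_succ, abs_of_nonneg (by positivity), Real.rpow_add hm, Real.rpow_one]
    push_cast
    rw [zero_sub, abs_neg, abs_of_nonneg hx]
    field_simp
  rw [h1]
  have h2 := rpow_div_factorial_mul_prod_le hx m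
  have h3 := rpow_self_mul_exp_neg_le_Gamma (s := x + 1) (by linarith)
  have h4 : (x + 1) ^ x ≤ (x + 1) ^ (x + 1) :=
    Real.rpow_le_rpow_of_exponent_le (by linarith) (by linarith)
  have h5 : (x + 1) ^ (x + 1) ≤ Real.exp (x + 1) * Real.Gamma (x + 2) := by
    calc (x + 1) ^ (x + 1) = Real.exp (x + 1) * ((x + 1) ^ (x + 1) * Real.exp (-(x + 1))) := by
          rw [mul_left_comm, ← Real.exp_add]; simp
      _ ≤ Real.exp (x + 1) * Real.Gamma (x + 1 + 1) := by gcongr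
      _ = _ := by congr 2; ring
  have h6 : x ≤ Real.exp (x + 1) := by
    have := Real.add_one_le_exp (x + 1); linarith
  calc _ ≤ Real.exp (x + 1) * ((Real.exp (x + 1) * Real.Gamma (x + 2)) * Real.exp (x + 1)) := by
        refine mul_le_mul h6 (h2.trans ?_) (by positivity) (by positivity)
        refine mul_le_mul (h4.trans h5) (by gcongr; linarith) (by positivity) (by positivity)
    _ = _ := by
      rw [show 3 * (x + 1) = (x + 1) + ((x + 1) + (x + 1)) by ring, Real.exp_add (x + 1),
        Real.exp_add (x + 1)]
      ring

theorem summable_Gamma_mul_Gamma_mul_pow_div_factorial {b D D' R : ℝ} (hb0 : 0 < b)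
    (hb1 : b < 1 / 2) (hD : 0 < D) (hD' : 0 < D') (hR : 0 < R) :
    Summable fun k : ℕ => Real.Gamma (k * b + D) * Real.Gamma (k * b + D') * R ^ k /
      (Nat.factorial k : ℝ) := by
  have hpos : ∀ (E : ℝ), 0 < E → ∀ k : ℕ, 0 < (k : ℝ) * b + E := fun E hE k => by positivity
  have hGpos : ∀ (E : ℝ), 0 < E → ∀ k : ℕ, 0 < Real.Gamma ((k : ℝ) * b + E) :=
    fun E hE k => Real.Gamma_pos_of_pos (hpos E hE k)
  have hstep : ∀ (E : ℝ), 0 < E → ∀ k : ℕ, Real.Gamma (((k + 1 : ℕ) : ℝ) * b + E) ≤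
      (k * b + E) ^ b * Real.Gamma (k * b + E) := fun E hE k => by
    have := Gamma_add_le_rpow_mul (hpos E hE k) hb0 (by linarith)
    convert this using 2
    push_cast; ring
  have hterm : ∀ k : ℕ, 0 < Real.Gamma (k * b + D) * Real.Gamma (k * b + D') * R ^ k /
      (Nat.factorial k : ℝ) := fun k => by
    have := hGpos D hD k
    have := hGpos D' hD' k
    positivity
  refine summable_of_ratio_test_tendsto_lt_one (l := 0) one_pos
    (Filter.Eventually.of_forall fun k => (hterm k).ne') ?_
  -- comparison with `(k + c) ^ (2 b - 1)`
  set c := b + 1 + D + D' with hc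
  have hc1 : 1 ≤ c := by linarith
  have hlim : Tendsto (fun k : ℕ => R * c ^ (2 * b) * ((k : ℝ) + 1) ^ (-(1 - 2 * b))) atTop (𝓝 0) := by
    have h1 : Tendsto (fun k : ℕ => (k : ℝ) + 1) atTop atTop :=
      tendsto_atTop_add_const_right _ _ tendsto_natCast_atTop_atTop
    have h2 := (tendsto_rpow_neg_atTop (y := 1 - 2 * b) (by linarith)).comp h1
    simpa using h2.const_mul (R * c ^ (2 * b))
  refine squeeze_zero (fun k => by positivity) (fun k => ?_) hlim
  rw [Real.norm_of_nonneg (hterm _).le, Real.norm_of_nonneg (hterm _).le, div_le_iff₀ (hterm k)]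
  have hk1 : (0 : ℝ) < (k : ℝ) + 1 := by positivity
  have hle : ∀ E : ℝ, 0 < E → E ≤ D + D' → ((k : ℝ) * b + E) ^ b ≤ (c * (k + 1)) ^ b := by
    intro E hE hE'
    have hk0 : (0 : ℝ) ≤ k := Nat.cast_nonneg k
    have := hpos E hE k
    have h2 : (k : ℝ) * b + E ≤ c * (k + 1) := by
      rw [hc]; nlinarith [mul_nonneg hk0 hD.le, mul_nonneg hk0 hD'.le]
    gcongr
  have hD1 := (hstep D hD k).trans
    (mul_le_mul_of_nonneg_right (hle D hD (by linarith)) (hGpos D hD k).le)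
  have hD2 := (hstep D' hD' k).trans
    (mul_le_mul_of_nonneg_right (hle D' hD' (by linarith)) (hGpos D' hD' k).le)
  have hck : (c * ((k : ℝ) + 1)) ^ b * (c * ((k : ℝ) + 1)) ^ b =
      c ^ (2 * b) * (((k : ℝ) + 1) ^ (-(1 - 2 * b)) * (k + 1)) := by
    rw [← Real.rpow_add (by positivity), ← two_mul, Real.mul_rpow (by positivity) hk1.le,
      ← Real.rpow_add_one hk1.ne']
    congr 2; ring
  have hg1 := hGpos D hD k
  have hg2 := hGpos D' hD' k
  have hg3 := hGpos D' hD' (k + 1)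
  have hf : (0 : ℝ) < Nat.factorial k := by exact_mod_cast Nat.factorial_pos k
  calc _ ≤ ((c * (k + 1)) ^ b * Real.Gamma (k * b + D)) *
        ((c * (k + 1)) ^ b * Real.Gamma (k * b + D')) * R ^ (k + 1) /
        (Nat.factorial (k + 1) : ℝ) := by gcongr
    _ = ((c * ((k : ℝ) + 1)) ^ b * (c * ((k : ℝ) + 1)) ^ b) * (Real.Gamma (k * b + D) *
          Real.Gamma (k * b + D') * R ^ (k + 1) / (Nat.factorial (k + 1) : ℝ)) := by ring
    _ = _ := by
      rw [hck, Nat.factorial_succ]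
      push_cast
      field_simp
      ring

theorem summable_abs_mul_pow {a : ℕ → ℝ} {b : ℝ} (hb : 0 < b)
    (ha : ∀ R : ℝ, 0 < R → Summable fun k : ℕ => |a k| * Real.Gamma (k * b + 2) * R ^ k)
    {R : ℝ} (hR : 0 < R) : Summable fun k : ℕ => |a k| * R ^ k := by
  refine Summable.of_nonneg_of_le (fun k => by positivity) (fun k => ?_) (ha R hR)
  have h1 : (1 : ℝ) ≤ Real.Gamma (k * b + 2) := by
    rw [← Real.Gamma_two]
    have h0 : (0 : ℝ) ≤ k * b := by positivity
    exact Real.Gamma_strictMonoOn_Ici.monotoneOn (Set.mem_Ici.2 le_rfl)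
      (Set.mem_Ici.2 (by linarith)) (by linarith)
  have h2 : 0 ≤ |a k| * R ^ k := by positivity
  nlinarith

/-- The `k`-th term of the `n`-th derivative of `∑ a_k t ^ (k b)`. -/
def derivTerm (a : ℕ → ℝ) (b : ℝ) (n k : ℕ) (t : ℝ) : ℝ :=
  a k * (∏ j ∈ Finset.range n, ((k : ℝ) * b - j)) * t ^ ((k : ℝ) * b - n)

theorem hasDerivAt_derivTerm (a : ℕ → ℝ) (b : ℝ) (n k : ℕ) {t : ℝ} (ht : 0 < t) :
    HasDerivAt (derivTerm a b n k) (derivTerm a b (n + 1) k t) t := by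
  have h := (Real.hasDerivAt_rpow_const (x := t) (p := (k : ℝ) * b - n)
    (Or.inl ht.ne')).const_mul (a k * (∏ j ∈ Finset.range n, ((k : ℝ) * b - j)))
  refine h.congr_deriv ?_
  rw [derivTerm, Finset.prod_range_succ]
  push_cast
  rw [show (k : ℝ) * b - (n + 1) = k * b - n - 1 by ring]
  ring

theorem abs_derivTerm_le (a : ℕ → ℝ) {b : ℝ} (hb : 0 < b) (n k : ℕ) {s t T : ℝ} (hs : 0 < s)
    (hst : s ≤ t) (htT : t ≤ T) :
    |derivTerm a b n k t| ≤ |a k| * ((Real.exp 1 * T) ^ b) ^ k *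
      ((Nat.factorial n : ℝ) * Real.exp n * s ^ (-(n : ℝ))) := by
  have ht : 0 < t := hs.trans_le hst
  have hT : 0 < T := ht.trans_le htT
  have hkb : 0 ≤ (k : ℝ) * b := by positivity
  have hprod : |∏ j ∈ Finset.range n, ((k : ℝ) * b - j)| ≤
      (Nat.factorial n : ℝ) * Real.exp (k * b + n) := by
    have hf : (0 : ℝ) < Nat.factorial n := by exact_mod_cast Nat.factorial_pos n
    rw [Finset.abs_prod]
    calc ∏ j ∈ Finset.range n, |(k : ℝ) * b - j| ≤ ∏ _j ∈ Finset.range n, ((k : ℝ) * b + n) := by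
          refine Finset.prod_le_prod (fun _ _ => abs_nonneg _) fun j hj => ?_
          have hj' : (j : ℝ) ≤ n := by exact_mod_cast (Finset.mem_range.1 hj).le
          have hj0 : (0 : ℝ) ≤ j := Nat.cast_nonneg j
          rw [abs_le]; constructor <;> linarith
      _ = ((k : ℝ) * b + n) ^ n := by simp
      _ ≤ _ := by
        have := Real.pow_div_factorial_le_exp ((k : ℝ) * b + n) (by positivity) n
        rwa [div_le_iff₀ hf, mul_comm (Real.exp _)] at this
  have hpow : t ^ ((k : ℝ) * b - n) ≤ T ^ ((k : ℝ) * b) * s ^ (-(n : ℝ)) := by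
    rw [sub_eq_add_neg, Real.rpow_add ht]
    refine mul_le_mul (Real.rpow_le_rpow ht.le htT hkb) ?_ (by positivity) (by positivity)
    exact Real.rpow_le_rpow_of_nonpos hs hst (by simp)
  rw [derivTerm, abs_mul, abs_mul, abs_of_pos (Real.rpow_pos_of_pos ht _)]
  calc _ ≤ |a k| * ((Nat.factorial n : ℝ) * Real.exp (k * b + n)) *
        (T ^ ((k : ℝ) * b) * s ^ (-(n : ℝ))) := by gcongr
    _ = _ := by
      rw [← Real.rpow_natCast ((Real.exp 1 * T) ^ b) k, ← Real.rpow_mul (by positivity),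
        Real.mul_rpow (by positivity) hT.le, ← Real.exp_mul, Real.exp_add, mul_comm b (k : ℝ)]
      ring_nf

section Laplace

variable {ν : Measure ℝ} [IsFiniteMeasure ν] {a : ℕ → ℝ} {b : ℝ}

theorem integrableExpSet_neg (hν : ∀ᵐ u ∂ν, 0 ≤ u) {t : ℝ} (ht : 0 < t) :
    -t ∈ interior (ProbabilityTheory.integrableExpSet (fun u : ℝ => u) ν) := by
  rw [mem_interior]
  refine ⟨Set.Iio 0, fun s hs => ?_, isOpen_Iio, by simpa using ht⟩
  have hs0 : s < 0 := hs
  rw [ProbabilityTheory.integrableExpSet, Set.mem_ofPred_eq]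
  refine Integrable.of_bound (by fun_prop) 1 ?_
  filter_upwards [hν] with u hu
  rw [Real.norm_of_nonneg (Real.exp_pos _).le, Real.exp_le_one_iff]
  exact mul_nonpos_of_nonpos_of_nonneg hs0.le hu

theorem integral_pow_mul_exp_eq_tsum (hν : ∀ᵐ u ∂ν, 0 ≤ u) (hb : 0 < b)
    (ha : ∀ R : ℝ, 0 < R → Summable fun k : ℕ => |a k| * Real.Gamma (k * b + 2) * R ^ k)
    (hL : ∀ t : ℝ, 0 < t → ∫ u, Real.exp (-t * u) ∂ν = ∑' k : ℕ, a k * t ^ ((k : ℝ) * b)) (n : ℕ) :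
    ∀ t : ℝ, 0 < t → (-1 : ℝ) ^ n * ∫ u, u ^ n * Real.exp (-t * u) ∂ν =
      ∑' k : ℕ, derivTerm a b n k t := by
  induction n with
  | zero =>
    intro t ht
    simpa [derivTerm] using hL t ht
  | succ n ih =>
    intro t ht
    have hbound : ∀ m k : ℕ, ∀ y ∈ Set.Ioo (t / 2) (2 * t), ‖derivTerm a b m k y‖ ≤
        |a k| * ((Real.exp 1 * (2 * t)) ^ b) ^ k *
          ((Nat.factorial m : ℝ) * Real.exp m * (t / 2) ^ (-(m : ℝ))) := fun m k y hy =>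
      abs_derivTerm_le a hb m k (by linarith) hy.1.le hy.2.le
    have hsum : ∀ m : ℕ, Summable fun k : ℕ => |a k| * ((Real.exp 1 * (2 * t)) ^ b) ^ k *
        ((Nat.factorial m : ℝ) * Real.exp m * (t / 2) ^ (-(m : ℝ))) := fun m =>
      (summable_abs_mul_pow hb ha (by positivity)).mul_right _
    have htm : t ∈ Set.Ioo (t / 2) (2 * t) := ⟨by linarith, by linarith⟩
    have hR : HasDerivAt (fun z => ∑' k : ℕ, derivTerm a b n k z)
        (∑' k : ℕ, derivTerm a b (n + 1) k t) t :=
      hasDerivAt_tsum_of_isPreconnected (hsum (n + 1)) isOpen_Ioo isPreconnected_Ioo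
        (fun k y hy => hasDerivAt_derivTerm a b n k (by linarith [hy.1]))
        (hbound (n + 1)) htm
        (Summable.of_norm_bounded (hsum n) fun k => hbound n k t htm) htm
    have hM := ProbabilityTheory.hasDerivAt_integral_pow_mul_exp_real
      (integrableExpSet_neg hν ht) n
    have hM' := ((HasDerivAt.scomp t hM (hasDerivAt_neg t)).const_mul ((-1 : ℝ) ^ n))
    have heq : (fun z => ∑' k : ℕ, derivTerm a b n k z) =ᶠ[𝓝 t]
        fun z => (-1 : ℝ) ^ n * ∫ u, u ^ n * Real.exp (-z * u) ∂ν := by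
      filter_upwards [lt_mem_nhds ht] with z hz using (ih z hz).symm
    have := (hR.congr_of_eventuallyEq heq.symm).unique hM'
    rw [this, pow_succ]
    simp

/-- The kernel of the Post–Widder inversion formula. -/
def postWidderKernel (n : ℕ) (u y : ℝ) : ℝ :=
  (n / y) ^ (n + 1) / (Nat.factorial n : ℝ) * (u ^ n * Real.exp (-(n / y) * u))

theorem integral_postWidderKernel_eq_tsum (hν : ∀ᵐ u ∂ν, 0 ≤ u) (hb : 0 < b)
    (ha : ∀ R : ℝ, 0 < R → Summable fun k : ℕ => |a k| * Real.Gamma (k * b + 2) * R ^ k)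
    (hL : ∀ t : ℝ, 0 < t → ∫ u, Real.exp (-t * u) ∂ν = ∑' k : ℕ, a k * t ^ ((k : ℝ) * b))
    {n : ℕ} (hn : n ≠ 0) {y : ℝ} (hy : 0 < y) :
    ∫ u, postWidderKernel n u y ∂ν =
      ∑' k : ℕ, a k * y ^ (-((k : ℝ) * b) - 1) * postWidderCoeff n (k * b) := by
  have hn0 : (0 : ℝ) < n := by exact_mod_cast Nat.pos_of_ne_zero hn
  have hny : 0 < (n : ℝ) / y := by positivity
  have h := integral_pow_mul_exp_eq_tsum hν hb ha hL n (n / y) hny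
  have h2 : ∫ u, u ^ n * Real.exp (-(n / y) * u) ∂ν =
      (-1 : ℝ) ^ n * ∑' k : ℕ, derivTerm a b n k (n / y) := by
    rw [← h, ← mul_assoc, ← mul_pow]; simp
  simp only [postWidderKernel]
  rw [integral_const_mul, h2, ← tsum_mul_left, ← tsum_mul_left]
  refine tsum_congr fun k => ?_
  have hprod : ∏ j ∈ Finset.range n, ((j : ℝ) - k * b) =
      (-1 : ℝ) ^ n * ∏ j ∈ Finset.range n, ((k : ℝ) * b - j) := by
    rw [← Finset.card_range n, ← Finset.prod_const, Finset.card_range, ← Finset.prod_mul_distrib]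
    exact Finset.prod_congr rfl fun j _ => by ring
  have hpow : ((n : ℝ) / y) ^ (n + 1) * (n / y) ^ ((k : ℝ) * b - n) =
      y ^ (-((k : ℝ) * b) - 1) * (n : ℝ) ^ ((k : ℝ) * b + 1) := by
    rw [← Real.rpow_natCast ((n : ℝ) / y) (n + 1), ← Real.rpow_add hny,
      show ((n + 1 : ℕ) : ℝ) + ((k : ℝ) * b - n) = k * b + 1 by push_cast; ring,
      Real.div_rpow hn0.le hy.le, show -((k : ℝ) * b) - 1 = -(k * b + 1) by ring,
      Real.rpow_neg hy.le]
    ring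
  rw [derivTerm, postWidderCoeff, hprod]
  linear_combination (a k / (Nat.factorial n : ℝ) * (-1 : ℝ) ^ n *
    ∏ j ∈ Finset.range n, ((k : ℝ) * b - j)) * hpow

/-- The inverse Laplace transform of `∑ a_k t ^ (k b)`. -/
def inverseLaplaceSeries (a : ℕ → ℝ) (b y : ℝ) : ℝ :=
  ∑' k : ℕ, a k * y ^ (-((k : ℝ) * b) - 1) * (1 / Real.Gamma (-((k : ℝ) * b)))

theorem abs_mul_rpow_mul_postWidderCoeff_le (a : ℕ → ℝ) (hb : 0 < b) {p y : ℝ} (hp : 0 < p)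
    (hy : p ≤ y) (n k : ℕ) :
    |a k * y ^ (-((k : ℝ) * b) - 1) * postWidderCoeff n (k * b)| ≤
      |a k| * Real.Gamma (k * b + 2) * ((Real.exp 3 / p) ^ b) ^ k * (Real.exp 3 / p) := by
  have hy0 : 0 < y := hp.trans_le hy
  have hkb : 0 ≤ (k : ℝ) * b := by positivity
  have h1 : y ^ (-((k : ℝ) * b) - 1) ≤ p ^ (-((k : ℝ) * b) - 1) :=
    Real.rpow_le_rpow_of_nonpos hp hy (by linarith)
  rw [abs_mul, abs_mul, abs_of_pos (Real.rpow_pos_of_pos hy0 _)]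
  calc _ ≤ |a k| * p ^ (-((k : ℝ) * b) - 1) *
        (Real.exp (3 * (k * b + 1)) * Real.Gamma (k * b + 2)) := by
        gcongr
        exact abs_postWidderCoeff_le hkb n
    _ = _ := by
      have h2 : p ^ (-((k : ℝ) * b) - 1) * Real.exp (3 * (k * b + 1)) =
          ((Real.exp 3 / p) ^ b) ^ k * (Real.exp 3 / p) := by
        rw [← Real.rpow_natCast, ← Real.rpow_mul (by positivity), mul_comm b (k : ℝ),
          ← Real.rpow_add_one (by positivity), Real.div_rpow (by positivity) hp.le, Real.exp_mul,
          show -((k : ℝ) * b) - 1 = -(k * b + 1) by ring, Real.rpow_neg hp.le]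
        ring
      linear_combination (|a k| * Real.Gamma (k * b + 2)) * h2

theorem summable_inverseLaplaceSeries (hb : 0 < b)
    (ha : ∀ R : ℝ, 0 < R → Summable fun k : ℕ => |a k| * Real.Gamma (k * b + 2) * R ^ k)
    {y : ℝ} (hy : 0 < y) :
    Summable fun k : ℕ => a k * y ^ (-((k : ℝ) * b) - 1) * (1 / Real.Gamma (-((k : ℝ) * b))) := by
  refine Summable.of_norm_bounded
    ((ha ((Real.exp 3 / y) ^ b) (by positivity)).mul_right (Real.exp 3 / y)) fun k => ?_
  refine le_of_tendsto ((tendsto_postWidderCoeff (k * b)).const_mul _).norm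
    (Filter.Eventually.of_forall fun n => ?_)
  exact abs_mul_rpow_mul_postWidderCoeff_le a hb hy le_rfl n k

theorem tendsto_integral_postWidderKernel (hν : ∀ᵐ u ∂ν, 0 ≤ u) (hb : 0 < b)
    (ha : ∀ R : ℝ, 0 < R → Summable fun k : ℕ => |a k| * Real.Gamma (k * b + 2) * R ^ k)
    (hL : ∀ t : ℝ, 0 < t → ∫ u, Real.exp (-t * u) ∂ν = ∑' k : ℕ, a k * t ^ ((k : ℝ) * b))
    {y : ℝ} (hy : 0 < y) :
    Tendsto (fun n => ∫ u, postWidderKernel n u y ∂ν) atTop (𝓝 (inverseLaplaceSeries a b y)) := by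
  have h : Tendsto (fun n => ∑' k : ℕ, a k * y ^ (-((k : ℝ) * b) - 1) * postWidderCoeff n (k * b))
      atTop (𝓝 (inverseLaplaceSeries a b y)) :=
    tendsto_tsum_of_dominated_convergence
      ((ha ((Real.exp 3 / y) ^ b) (by positivity)).mul_right (Real.exp 3 / y))
      (fun k => (tendsto_postWidderCoeff (k * b)).const_mul _)
      (Filter.Eventually.of_forall fun n k =>
        abs_mul_rpow_mul_postWidderCoeff_le a hb hy le_rfl n k)
  refine h.congr' ?_
  filter_upwards [eventually_ne_atTop 0] with n hn
  exact (integral_postWidderKernel_eq_tsum hν hb ha hL hn hy).symm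

theorem abs_integral_postWidderKernel_le (hν : ∀ᵐ u ∂ν, 0 ≤ u) (hb : 0 < b)
    (ha : ∀ R : ℝ, 0 < R → Summable fun k : ℕ => |a k| * Real.Gamma (k * b + 2) * R ^ k)
    (hL : ∀ t : ℝ, 0 < t → ∫ u, Real.exp (-t * u) ∂ν = ∑' k : ℕ, a k * t ^ ((k : ℝ) * b))
    {n : ℕ} (hn : n ≠ 0) {p y : ℝ} (hp : 0 < p) (hy : p ≤ y) :
    |∫ u, postWidderKernel n u y ∂ν| ≤ ∑' k : ℕ,
      |a k| * Real.Gamma (k * b + 2) * ((Real.exp 3 / p) ^ b) ^ k * (Real.exp 3 / p) := by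
  rw [integral_postWidderKernel_eq_tsum hν hb ha hL hn (hp.trans_le hy)]
  rw [← Real.norm_eq_abs]
  exact tsum_of_norm_bounded
    ((ha ((Real.exp 3 / p) ^ b) (by positivity)).mul_right (Real.exp 3 / p)).hasSum
    fun k => abs_mul_rpow_mul_postWidderCoeff_le a hb hp hy n k

end Laplace

/-- The density of the Gamma distribution with mean `1` and variance `1 / n`. -/
def unitGammaDensity (n : ℕ) (s : ℝ) : ℝ :=
  (n : ℝ) ^ (n : ℝ) / Real.Gamma n * (s ^ ((n : ℝ) - 1) * Real.exp (-((n : ℝ) * s)))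

theorem unitGammaDensity_nonneg (n : ℕ) {s : ℝ} (hs : 0 ≤ s) : 0 ≤ unitGammaDensity n s := by
  have : 0 ≤ Real.Gamma n := Real.Gamma_nonneg_of_nonneg (Nat.cast_nonneg n)
  unfold unitGammaDensity
  positivity

theorem integrableOn_pow_mul_unitGammaDensity {n : ℕ} (hn : n ≠ 0) (j : ℕ) :
    IntegrableOn (fun s => s ^ j * unitGammaDensity n s) (Set.Ioi 0) := by
  have hn0 : (0 : ℝ) < n := by exact_mod_cast Nat.pos_of_ne_zero hn
  have hj : (0 : ℝ) ≤ j := Nat.cast_nonneg j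
  have h := (integrableOn_rpow_mul_exp_neg_mul_rpow (p := 1) (s := (n : ℝ) + j - 1) (b := n)
    (by linarith) one_pos hn0).const_mul ((n : ℝ) ^ (n : ℝ) / Real.Gamma n)
  refine IntegrableOn.congr_fun h (fun s hs => ?_) measurableSet_Ioi
  have hs0 : 0 < s := hs
  simp only [unitGammaDensity]
  rw [Real.rpow_one, show (n : ℝ) + j - 1 = j + (n - 1) by ring, Real.rpow_add hs0,
    Real.rpow_natCast s j]
  ring_nf

theorem integral_pow_mul_unitGammaDensity {n : ℕ} (hn : n ≠ 0) (j : ℕ) :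
    ∫ s in Set.Ioi (0 : ℝ), s ^ j * unitGammaDensity n s =
      Real.Gamma (n + j) / Real.Gamma n / (n : ℝ) ^ j := by
  have hn0 : (0 : ℝ) < n := by exact_mod_cast Nat.pos_of_ne_zero hn
  have hj : (0 : ℝ) ≤ j := Nat.cast_nonneg j
  have h := Real.integral_rpow_mul_exp_neg_mul_Ioi (a := (n : ℝ) + j) (r := n) (by linarith) hn0
  have h2 : ∫ s in Set.Ioi (0 : ℝ), s ^ j * unitGammaDensity n s = ∫ s in Set.Ioi (0 : ℝ),
      ((n : ℝ) ^ (n : ℝ) / Real.Gamma n) *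
        (s ^ ((n : ℝ) + j - 1) * Real.exp (-((n : ℝ) * s))) := by
    refine setIntegral_congr_fun measurableSet_Ioi fun s hs => ?_
    have hs0 : 0 < s := hs
    simp only [unitGammaDensity]
    rw [show (n : ℝ) + j - 1 = j + (n - 1) by ring, Real.rpow_add hs0, Real.rpow_natCast s j]
    ring
  rw [h2, integral_const_mul, h, one_div, Real.inv_rpow hn0.le, Real.rpow_add hn0,
    Real.rpow_natCast _ j]
  have h3 : (n : ℝ) ^ (n : ℝ) ≠ 0 := (Real.rpow_pos_of_pos hn0 _).ne'
  have h4 : Real.Gamma n ≠ 0 := (Real.Gamma_pos_of_pos hn0).ne'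
  field_simp

theorem integral_unitGammaDensity {n : ℕ} (hn : n ≠ 0) :
    ∫ s in Set.Ioi 0, unitGammaDensity n s = 1 := by
  have hn0 : (0 : ℝ) < n := by exact_mod_cast Nat.pos_of_ne_zero hn
  have h := integral_pow_mul_unitGammaDensity hn 0
  simpa [(Real.Gamma_pos_of_pos hn0).ne'] using h

theorem integrableOn_unitGammaDensity {n : ℕ} (hn : n ≠ 0) :
    IntegrableOn (unitGammaDensity n) (Set.Ioi 0) := by
  simpa using integrableOn_pow_mul_unitGammaDensity hn 0

theorem integrableOn_sub_one_sq_mul_unitGammaDensity {n : ℕ} (hn : n ≠ 0) :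
    IntegrableOn (fun s => (s - 1) ^ 2 * unitGammaDensity n s) (Set.Ioi 0) := by
  have h := ((integrableOn_pow_mul_unitGammaDensity hn 2).sub
    ((integrableOn_pow_mul_unitGammaDensity hn 1).const_mul 2)).add
    (integrableOn_pow_mul_unitGammaDensity hn 0)
  refine h.congr (Filter.Eventually.of_forall fun s => ?_)
  simp only [Pi.add_apply, Pi.sub_apply]
  ring

theorem integral_sub_one_sq_mul_unitGammaDensity {n : ℕ} (hn : n ≠ 0) :
    ∫ s in Set.Ioi (0 : ℝ), (s - 1) ^ 2 * unitGammaDensity n s = (1 : ℝ) / n := by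
  have hn0 : (0 : ℝ) < n := by exact_mod_cast Nat.pos_of_ne_zero hn
  have i0 := integrableOn_pow_mul_unitGammaDensity hn 0
  have i1 := (integrableOn_pow_mul_unitGammaDensity hn 1).const_mul 2
  have i2 := integrableOn_pow_mul_unitGammaDensity hn 2
  have h : ∫ s in Set.Ioi (0 : ℝ), (s - 1) ^ 2 * unitGammaDensity n s = ∫ s in Set.Ioi (0 : ℝ),
      (s ^ 2 * unitGammaDensity n s - 2 * (s ^ 1 * unitGammaDensity n s) +
        s ^ 0 * unitGammaDensity n s) :=
    integral_congr_ae (Filter.Eventually.of_forall fun s => by ring)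
  have h0 : Integrable (fun s => s ^ 2 * unitGammaDensity n s -
      2 * (s ^ 1 * unitGammaDensity n s)) (volume.restrict (Set.Ioi 0)) := i2.sub i1
  rw [h, integral_add h0 i0, integral_sub i2 i1, integral_const_mul,
    integral_pow_mul_unitGammaDensity hn, integral_pow_mul_unitGammaDensity hn,
    integral_pow_mul_unitGammaDensity hn]
  have h1 : Real.Gamma ((n : ℝ) + 1) = n * Real.Gamma n := Real.Gamma_add_one hn0.ne'
  have h2 : Real.Gamma ((n : ℝ) + 2) = (n + 1) * (n * Real.Gamma n) := by
    rw [← h1, ← Real.Gamma_add_one (by positivity)]; ring_nf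
  have h4 : Real.Gamma n ≠ 0 := (Real.Gamma_pos_of_pos hn0).ne'
  push_cast
  rw [h1, h2, add_zero]
  field_simp
  ring

theorem integrableOn_mul_unitGammaDensity {n : ℕ} (hn : n ≠ 0) {ψ : ℝ → ℝ} (hψm : Measurable ψ)
    {C : ℝ} (hψ : ∀ s, |ψ s| ≤ C) : IntegrableOn (fun s => ψ s * unitGammaDensity n s) (Set.Ioi 0) :=
  (integrableOn_unitGammaDensity hn).bdd_mul hψm.aestronglyMeasurable
    (Filter.Eventually.of_forall hψ)

theorem abs_integral_mul_unitGammaDensity_le {n : ℕ} (hn : n ≠ 0) {ψ : ℝ → ℝ}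
    (hψ : ∀ s, |ψ s| ≤ 1) : |∫ s in Set.Ioi 0, ψ s * unitGammaDensity n s| ≤ 1 := by
  rw [← integral_unitGammaDensity hn, ← Real.norm_eq_abs]
  refine norm_integral_le_of_norm_le (integrableOn_unitGammaDensity hn) ?_
  filter_upwards [ae_restrict_mem measurableSet_Ioi] with s hs
  have h0 := unitGammaDensity_nonneg n (le_of_lt hs)
  rw [norm_mul, Real.norm_of_nonneg h0]
  exact mul_le_of_le_one_left h0 (hψ s)

theorem tendsto_integral_mul_unitGammaDensity {ψ : ℝ → ℝ} (hψm : Measurable ψ)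
    (hψ : ∀ s, |ψ s| ≤ 1) (hψc : ContinuousAt ψ 1) :
    Tendsto (fun n => ∫ s in Set.Ioi 0, ψ s * unitGammaDensity n s) atTop (𝓝 (ψ 1)) := by
  rw [Metric.tendsto_atTop]
  intro ε hε
  obtain ⟨δ, hδ, hδψ⟩ := Metric.continuousAt_iff.1 hψc (ε / 2) (by positivity)
  have hpt : ∀ s, |ψ s - ψ 1| ≤ ε / 2 + 2 / δ ^ 2 * (s - 1) ^ 2 := fun s => by
    rcases lt_or_ge (dist s 1) δ with h | h
    · have h1 := hδψ h
      rw [Real.dist_eq] at h1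
      have : 0 ≤ 2 / δ ^ 2 * (s - 1) ^ 2 := by positivity
      linarith
    · have h1 : |ψ s - ψ 1| ≤ 2 := (abs_sub _ _).trans (by linarith [hψ s, hψ 1])
      have h2 : 2 ≤ 2 / δ ^ 2 * (s - 1) ^ 2 := by
        rw [div_mul_eq_mul_div, le_div_iff₀ (by positivity)]
        rw [Real.dist_eq] at h
        have : δ ^ 2 ≤ (s - 1) ^ 2 := by rw [← sq_abs (s - 1)]; gcongr
        linarith
      linarith
  obtain ⟨N, hN⟩ := exists_nat_gt (4 / (δ ^ 2 * ε))
  refine ⟨max N 1, fun n hn => ?_⟩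
  have hn1 : n ≠ 0 := by have := le_of_max_le_right hn; omega
  have hn0 : (0 : ℝ) < n := by exact_mod_cast Nat.pos_of_ne_zero hn1
  have hnN : (N : ℝ) ≤ n := by exact_mod_cast le_of_max_le_left hn
  have i1 := integrableOn_mul_unitGammaDensity hn1 hψm hψ
  have i2 := (integrableOn_unitGammaDensity hn1).const_mul (ψ 1)
  have i3 := ((integrableOn_unitGammaDensity hn1).const_mul (ε / 2))
  have i4 := ((integrableOn_sub_one_sq_mul_unitGammaDensity hn1).const_mul (2 / δ ^ 2))
  have hdiff : (∫ s in Set.Ioi 0, ψ s * unitGammaDensity n s) - ψ 1 =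
      ∫ s in Set.Ioi 0, (ψ s * unitGammaDensity n s - ψ 1 * unitGammaDensity n s) := by
    rw [integral_sub i1 i2, integral_const_mul, integral_unitGammaDensity hn1, mul_one]
  rw [Real.dist_eq, hdiff, ← Real.norm_eq_abs]
  calc _ ≤ ∫ s in Set.Ioi 0, (ε / 2 * unitGammaDensity n s +
        2 / δ ^ 2 * ((s - 1) ^ 2 * unitGammaDensity n s)) := by
        refine norm_integral_le_of_norm_le (i3.add i4) ?_
        filter_upwards [ae_restrict_mem measurableSet_Ioi] with s hs
        have h0 := unitGammaDensity_nonneg n (le_of_lt hs)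
        rw [← sub_mul, norm_mul, Real.norm_of_nonneg h0, ← mul_assoc, ← add_mul]
        exact mul_le_mul_of_nonneg_right (hpt s) h0
    _ = ε / 2 + 2 / δ ^ 2 * (1 / n) := by
        rw [integral_add i3 i4, integral_const_mul, integral_const_mul,
          integral_unitGammaDensity hn1, integral_sub_one_sq_mul_unitGammaDensity hn1, mul_one]
    _ < ε := by
        have : 2 / δ ^ 2 * (1 / n) < ε / 2 := by
          have h5 := hN.trans_le hnN
          rw [div_lt_iff₀ (by positivity)] at h5
          rw [div_mul_div_comm, div_lt_iff₀ (by positivity)]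
          linarith
        linarith

theorem integral_mul_postWidderKernel {n : ℕ} (hn : n ≠ 0) {u : ℝ} (hu : 0 < u) (φ : ℝ → ℝ) :
    ∫ y in Set.Ioi 0, φ y * postWidderKernel n u y =
      ∫ s in Set.Ioi 0, φ (u / s) * unitGammaDensity n s := by
  have hn0 : (0 : ℝ) < n := by exact_mod_cast Nat.pos_of_ne_zero hn
  have h1 := integral_comp_mul_left_Ioi (fun y => φ y * postWidderKernel n u y) 0 hu
  rw [mul_zero, smul_eq_mul, eq_inv_mul_iff_mul_eq₀ hu.ne'] at h1
  rw [← h1, ← integral_comp_rpow_Ioi (fun x => φ (u * x) * postWidderKernel n u (u * x))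
    (p := -1) (by norm_num), ← integral_const_mul]
  refine setIntegral_congr_fun measurableSet_Ioi fun s hs => ?_
  have hs0 : 0 < s := hs
  simp only [unitGammaDensity, postWidderKernel, smul_eq_mul]
  obtain ⟨m, rfl⟩ := Nat.exists_eq_succ_of_ne_zero hn
  have hf : (0 : ℝ) < Nat.factorial m := by exact_mod_cast Nat.factorial_pos m
  rw [Real.rpow_neg_one, ← div_eq_mul_inv, Real.rpow_natCast,
    show ((m.succ : ℕ) : ℝ) = m + 1 by push_cast; ring, Real.Gamma_nat_eq_factorial,
    show (-1 : ℝ) - 1 = -((2 : ℕ) : ℝ) by norm_num, Real.rpow_neg hs0.le, Real.rpow_natCast,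
    add_sub_cancel_right, Real.rpow_natCast, Nat.succ_eq_add_one, Nat.factorial_succ]
  have he : -(((m : ℝ) + 1) / (u / s)) * u = -((m + 1) * s) := by field_simp
  rw [he]
  push_cast
  have hm1 : (m : ℝ) + 1 ≠ 0 := by positivity
  simp only [abs_neg, abs_one]
  field_simp
  rw [div_pow, mul_pow]
  field_simp
  ring

theorem abs_setIntegral_mul_postWidderKernel_le {n : ℕ} (hn : n ≠ 0) {u : ℝ} (hu : 0 ≤ u)
    {φ : ℝ → ℝ} (hφ : ∀ y, |φ y| ≤ 1) :
    |∫ y in Set.Ioi 0, φ y * postWidderKernel n u y| ≤ 1 := by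
  rcases hu.eq_or_lt with rfl | hu
  · simp [postWidderKernel, hn]
  · rw [integral_mul_postWidderKernel hn hu]
    exact abs_integral_mul_unitGammaDensity_le hn fun s => hφ _

theorem tendsto_setIntegral_mul_postWidderKernel {u : ℝ} (hu : 0 ≤ u) {φ : ℝ → ℝ}
    (hφc : Continuous φ) (hφ : ∀ y, |φ y| ≤ 1) (hφ0 : φ 0 = 0) :
    Tendsto (fun n => ∫ y in Set.Ioi 0, φ y * postWidderKernel n u y) atTop (𝓝 (φ u)) := by
  rcases hu.eq_or_lt with rfl | hu
  · rw [hφ0]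
    refine tendsto_const_nhds.congr' ?_
    filter_upwards [eventually_ne_atTop 0] with n hn
    simp [postWidderKernel, hn]
  · have h := tendsto_integral_mul_unitGammaDensity (ψ := fun s => φ (u / s))
      (hφc.measurable.comp (measurable_const.div measurable_id)) (fun s => hφ _)
      (hφc.continuousAt.comp (continuousAt_const.div continuousAt_id one_ne_zero))
    rw [div_one] at h
    refine h.congr' ?_
    filter_upwards [eventually_ne_atTop 0] with n hn
    exact (integral_mul_postWidderKernel hn hu φ).symm

theorem postWidderKernel_nonneg (n : ℕ) {u y : ℝ} (hu : 0 ≤ u) (hy : 0 < y) :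
    0 ≤ postWidderKernel n u y := by
  unfold postWidderKernel
  positivity

theorem postWidderKernel_le (n : ℕ) {u p y : ℝ} (hu : 0 ≤ u) (hp : 0 < p) (hy : p ≤ y) :
    postWidderKernel n u y ≤ n / p := by
  have hy0 : 0 < y := hp.trans_le hy
  have hz : 0 ≤ (n : ℝ) / y * u := by positivity
  have h1 : ((n : ℝ) / y * u) ^ n / (Nat.factorial n : ℝ) * Real.exp (-((n : ℝ) / y * u)) ≤ 1 := by
    rw [Real.exp_neg, ← div_eq_mul_inv, div_le_one (Real.exp_pos _)]
    exact Real.pow_div_factorial_le_exp _ hz n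
  calc postWidderKernel n u y = n / y *
        (((n : ℝ) / y * u) ^ n / (Nat.factorial n : ℝ) * Real.exp (-((n : ℝ) / y * u))) := by
        rw [postWidderKernel, mul_pow, pow_succ]
        ring_nf
    _ ≤ n / y * 1 := by gcongr
    _ ≤ n / p := by rw [mul_one]; gcongr

theorem measurable_postWidderKernel (n : ℕ) :
    Measurable (Function.uncurry (postWidderKernel n)) := by
  unfold Function.uncurry postWidderKernel
  fun_prop

theorem measurable_inverseLaplaceSeries (a : ℕ → ℝ) (b : ℝ) :
    Measurable (inverseLaplaceSeries a b) :=
  Measurable.tsum fun k => by fun_prop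

/-- A continuous approximation from below of the indicator function of `(a, b)`. -/
def bumpIoo (a b : ℝ) (m : ℕ) (y : ℝ) : ℝ := max 0 (min 1 ((m + 1) * min (y - a) (b - y) - 1))

theorem continuous_bumpIoo (a b : ℝ) (m : ℕ) : Continuous (bumpIoo a b m) := by
  unfold bumpIoo
  fun_prop

theorem bumpIoo_nonneg (a b : ℝ) (m : ℕ) (y : ℝ) : 0 ≤ bumpIoo a b m y := le_max_left _ _

theorem abs_bumpIoo_le (a b : ℝ) (m : ℕ) (y : ℝ) : |bumpIoo a b m y| ≤ 1 := by
  rw [abs_of_nonneg (bumpIoo_nonneg a b m y)]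
  exact max_le zero_le_one (min_le_left _ _)

theorem bumpIoo_of_nonpos {a b y : ℝ} (m : ℕ) (h : (m + 1) * min (y - a) (b - y) ≤ 1) :
    bumpIoo a b m y = 0 :=
  max_eq_left ((min_le_right _ _).trans (by linarith))

theorem bumpIoo_eq_zero {a b y : ℝ} (m : ℕ) (hy : y ∉ Set.Icc (a + 1 / (m + 1)) b) :
    bumpIoo a b m y = 0 := by
  have hm : (0 : ℝ) < m + 1 := by positivity
  refine bumpIoo_of_nonpos m ?_
  rw [Set.mem_Icc, not_and_or, not_le, not_le] at hy
  rw [mul_comm, ← le_div_iff₀ hm]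
  rcases hy with hy | hy
  · exact (min_le_left _ _).trans (by linarith)
  · exact (min_le_right _ _).trans (by have : 0 < 1 / ((m : ℝ) + 1) := by positivity
                                       linarith)

theorem monotone_bumpIoo (a b y : ℝ) : Monotone fun m => bumpIoo a b m y := by
  intro m m' h
  rcases le_or_gt (min (y - a) (b - y)) 0 with h0 | h0
  · refine (bumpIoo_of_nonpos m ?_).le.trans (bumpIoo_nonneg _ _ _ _)
    have : (0 : ℝ) < m + 1 := by positivity
    nlinarith
  · simp only [bumpIoo]
    gcongr

theorem tendsto_bumpIoo (a b y : ℝ) :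
    Tendsto (fun m => bumpIoo a b m y) atTop (𝓝 ((Set.Ioo a b).indicator 1 y)) := by
  by_cases hy : y ∈ Set.Ioo a b
  · have h0 : 0 < min (y - a) (b - y) := lt_min (by linarith [hy.1]) (by linarith [hy.2])
    rw [Set.indicator_of_mem hy, Pi.one_apply]
    obtain ⟨N, hN⟩ := exists_nat_gt (2 / min (y - a) (b - y))
    refine tendsto_const_nhds.congr' ?_
    filter_upwards [eventually_ge_atTop N] with m hm
    have hm' : (N : ℝ) ≤ m := by exact_mod_cast hm
    rw [div_lt_iff₀ h0] at hN
    rw [bumpIoo, min_eq_left (by nlinarith), max_eq_right zero_le_one]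
  · rw [Set.indicator_of_notMem hy]
    refine tendsto_const_nhds.congr fun m => (bumpIoo_of_nonpos m ?_).symm
    have h0 : min (y - a) (b - y) ≤ 0 := by
      rw [Set.mem_Ioo, not_and_or, not_lt, not_lt] at hy
      rcases hy with hy | hy
      · exact (min_le_left _ _).trans (by linarith)
      · exact (min_le_right _ _).trans (by linarith)
    have : (0 : ℝ) < m + 1 := by positivity
    nlinarith

theorem setLIntegral_eq_of_subset_of_forall_notMem_eq_zero {s t : Set ℝ} (hs : MeasurableSet s)
    (ht : MeasurableSet t) (hst : s ⊆ t) {f : ℝ → ℝ≥0∞} (h : ∀ y, y ∉ s → f y = 0) :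
    ∫⁻ y in s, f y = ∫⁻ y in t, f y := by
  rw [← lintegral_indicator hs, ← lintegral_indicator ht]
  refine lintegral_congr fun y => ?_
  by_cases hy : y ∈ s
  · rw [Set.indicator_of_mem hy, Set.indicator_of_mem (hst hy)]
  · rw [Set.indicator_of_notMem hy, Set.indicator_apply_eq_zero.2 fun _ => h y hy]

section Inversion

variable {ν : Measure ℝ} [IsFiniteMeasure ν] {a : ℕ → ℝ} {b : ℝ}

theorem integral_mul_integral_postWidderKernel (hν : ∀ᵐ u ∂ν, 0 ≤ u) (n : ℕ) {φ : ℝ → ℝ}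
    (hφc : Continuous φ) (hφ : ∀ y, |φ y| ≤ 1) {p q : ℝ} (hp : 0 < p)
    (hφ0 : ∀ y, y ∉ Set.Icc p q → φ y = 0) :
    ∫ y in Set.Icc p q, φ y * ∫ u, postWidderKernel n u y ∂ν =
      ∫ u, (∫ y in Set.Ioi 0, φ y * postWidderKernel n u y) ∂ν := by
  have hint : Integrable (Function.uncurry fun y u => φ y * postWidderKernel n u y)
      ((volume.restrict (Set.Icc p q)).prod ν) := by
    have hm : Measurable (Function.uncurry fun y u => φ y * postWidderKernel n u y) :=
      (hφc.measurable.comp measurable_fst).mul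
        ((measurable_postWidderKernel n).comp measurable_swap)
    refine Integrable.of_bound hm.aestronglyMeasurable (n / p) ?_
    filter_upwards [Measure.quasiMeasurePreserving_snd.ae hν,
      Measure.quasiMeasurePreserving_fst.ae
        (ae_restrict_mem (measurableSet_Icc : MeasurableSet (Set.Icc p q)))] with x h1 h2
    have h3 := postWidderKernel_nonneg n h1 (hp.trans_le h2.1)
    simp only [Function.uncurry, norm_mul, Real.norm_eq_abs, abs_of_nonneg h3]
    exact (mul_le_of_le_one_left h3 (hφ _)).trans (postWidderKernel_le n h1 hp h2.1)
  simp_rw [← integral_const_mul]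
  rw [integral_integral_swap hint]
  refine integral_congr_ae (Filter.Eventually.of_forall fun u => ?_)
  refine (setIntegral_eq_of_subset_of_forall_sdiff_eq_zero measurableSet_Ioi
    (fun y hy => hp.trans_le hy.1) fun y hy => ?_).symm
  rw [hφ0 y hy.2, zero_mul]

variable (hν : ∀ᵐ u ∂ν, 0 ≤ u) (hb : 0 < b)
  (ha : ∀ R : ℝ, 0 < R → Summable fun k : ℕ => |a k| * Real.Gamma (k * b + 2) * R ^ k)
  (hL : ∀ t : ℝ, 0 < t → ∫ u, Real.exp (-t * u) ∂ν = ∑' k : ℕ, a k * t ^ ((k : ℝ) * b))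

include hν hb ha hL

theorem inverseLaplaceSeries_nonneg {y : ℝ} (hy : 0 < y) : 0 ≤ inverseLaplaceSeries a b y := by
  refine ge_of_tendsto (tendsto_integral_postWidderKernel hν hb ha hL hy)
    (Filter.Eventually.of_forall fun n => integral_nonneg_of_ae ?_)
  filter_upwards [hν] with u hu using postWidderKernel_nonneg n hu hy

theorem exists_abs_inverseLaplaceSeries_le {p : ℝ} (hp : 0 < p) :
    ∃ C, ∀ y, p ≤ y → |inverseLaplaceSeries a b y| ≤ C := by
  refine ⟨∑' k : ℕ,
    |a k| * Real.Gamma (k * b + 2) * ((Real.exp 3 / p) ^ b) ^ k * (Real.exp 3 / p),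
    fun y hy => le_of_tendsto
    (tendsto_integral_postWidderKernel hν hb ha hL (hp.trans_le hy)).abs ?_⟩
  filter_upwards [eventually_ne_atTop 0] with n hn
  exact abs_integral_postWidderKernel_le hν hb ha hL hn hp hy

theorem integral_eq_setIntegral_mul_inverseLaplaceSeries {φ : ℝ → ℝ}
    (hφc : Continuous φ) (hφ : ∀ y, |φ y| ≤ 1) {p q : ℝ} (hp : 0 < p)
    (hφ0 : ∀ y, y ∉ Set.Icc p q → φ y = 0) :
    ∫ u, φ u ∂ν = ∫ y in Set.Icc p q, φ y * inverseLaplaceSeries a b y := by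
  have h1 : Tendsto (fun n : ℕ => ∫ y in Set.Icc p q, φ y * ∫ u, postWidderKernel (n + 1) u y ∂ν)
      atTop (𝓝 (∫ y in Set.Icc p q, φ y * inverseLaplaceSeries a b y)) := by
    refine tendsto_integral_of_dominated_convergence (fun _ => ∑' k : ℕ,
      |a k| * Real.Gamma (k * b + 2) * ((Real.exp 3 / p) ^ b) ^ k * (Real.exp 3 / p))
      (fun n => ?_) (integrable_const _) (fun n => ?_) ?_
    · exact (hφc.stronglyMeasurable.mul (StronglyMeasurable.integral_prod_right
        (f := fun y u => postWidderKernel (n + 1) u y) ((measurable_postWidderKernel (n + 1)).comp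
          measurable_swap).stronglyMeasurable)).aestronglyMeasurable
    · filter_upwards [ae_restrict_mem measurableSet_Icc] with y hy
      rw [norm_mul, Real.norm_eq_abs, Real.norm_eq_abs]
      exact (mul_le_of_le_one_left (abs_nonneg _) (hφ y)).trans
        (abs_integral_postWidderKernel_le hν hb ha hL n.succ_ne_zero hp hy.1)
    · filter_upwards [ae_restrict_mem measurableSet_Icc] with y hy
      exact ((tendsto_integral_postWidderKernel hν hb ha hL (hp.trans_le hy.1)).comp
        (tendsto_add_atTop_nat 1)).const_mul _
  have h2 : Tendsto (fun n : ℕ => ∫ u, (∫ y in Set.Ioi 0, φ y * postWidderKernel (n + 1) u y) ∂ν)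
      atTop (𝓝 (∫ u, φ u ∂ν)) := by
    refine tendsto_integral_of_dominated_convergence (fun _ => 1)
      (fun n => ?_) (integrable_const _) (fun n => ?_) ?_
    · exact (StronglyMeasurable.integral_prod_right
        (f := fun u y => φ y * postWidderKernel (n + 1) u y)
        ((hφc.measurable.comp measurable_snd).mul
          (measurable_postWidderKernel (n + 1))).stronglyMeasurable).aestronglyMeasurable
    · filter_upwards [hν] with u hu
      exact abs_setIntegral_mul_postWidderKernel_le n.succ_ne_zero hu hφ
    · filter_upwards [hν] with u hu
      exact (tendsto_setIntegral_mul_postWidderKernel hu hφc hφ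
        (hφ0 0 fun h => hp.not_ge h.1)).comp (tendsto_add_atTop_nat 1)
  refine tendsto_nhds_unique h2 (h1.congr fun n => ?_)
  exact integral_mul_integral_postWidderKernel hν (n + 1) hφc hφ hp hφ0

theorem measure_Ioo_eq_lintegral_inverseLaplaceSeries {c e : ℝ} (hc : 0 ≤ c) :
    ν (Set.Ioo c e) = ∫⁻ y in Set.Ioo c e, ENNReal.ofReal (inverseLaplaceSeries a b y) := by
  have hl : Tendsto (fun m => ∫⁻ u, ENNReal.ofReal (bumpIoo c e m u) ∂ν) atTop
      (𝓝 (∫⁻ u, ENNReal.ofReal ((Set.Ioo c e).indicator 1 u) ∂ν)) :=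
    lintegral_tendsto_of_tendsto_of_monotone
      (fun m => (continuous_bumpIoo c e m).measurable.ennreal_ofReal.aemeasurable)
      (Filter.Eventually.of_forall fun u m m' h =>
        ENNReal.ofReal_le_ofReal (monotone_bumpIoo c e u h))
      (Filter.Eventually.of_forall fun u => ENNReal.tendsto_ofReal (tendsto_bumpIoo c e u))
  have hr : Tendsto (fun m => ∫⁻ y in Set.Ioi 0,
      ENNReal.ofReal (bumpIoo c e m y * inverseLaplaceSeries a b y)) atTop
      (𝓝 (∫⁻ y in Set.Ioi 0,
        ENNReal.ofReal ((Set.Ioo c e).indicator 1 y * inverseLaplaceSeries a b y))) := by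
    refine lintegral_tendsto_of_tendsto_of_monotone
      (fun m => ((continuous_bumpIoo c e m).measurable.mul
        (measurable_inverseLaplaceSeries a b)).ennreal_ofReal.aemeasurable) ?_ ?_
    · filter_upwards [ae_restrict_mem measurableSet_Ioi] with y hy m m' h
      exact ENNReal.ofReal_le_ofReal (mul_le_mul_of_nonneg_right (monotone_bumpIoo c e y h)
        (inverseLaplaceSeries_nonneg hν hb ha hL hy))
    · exact Filter.Eventually.of_forall fun y =>
        ENNReal.tendsto_ofReal ((tendsto_bumpIoo c e y).mul_const _)
  have heq : ∀ m, ∫⁻ u, ENNReal.ofReal (bumpIoo c e m u) ∂ν = ∫⁻ y in Set.Ioi 0,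
      ENNReal.ofReal (bumpIoo c e m y * inverseLaplaceSeries a b y) := fun m => by
    have hm : (0 : ℝ) < c + 1 / (m + 1) := by positivity
    obtain ⟨C, hC⟩ := exists_abs_inverseLaplaceSeries_le hν hb ha hL hm
    have hi : IntegrableOn (fun y => bumpIoo c e m y * inverseLaplaceSeries a b y)
        (Set.Icc (c + 1 / (m + 1)) e) := by
      refine Integrable.of_bound ((continuous_bumpIoo c e m).measurable.mul
        (measurable_inverseLaplaceSeries a b)).aestronglyMeasurable C ?_
      filter_upwards [ae_restrict_mem measurableSet_Icc] with y hy
      rw [norm_mul, Real.norm_eq_abs, Real.norm_eq_abs]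
      exact (mul_le_of_le_one_left (abs_nonneg _) (abs_bumpIoo_le c e m y)).trans (hC y hy.1)
    rw [← ofReal_integral_eq_lintegral_ofReal
        (Integrable.of_bound (continuous_bumpIoo c e m).aestronglyMeasurable 1
          (Filter.Eventually.of_forall (abs_bumpIoo_le c e m)))
        (Filter.Eventually.of_forall (bumpIoo_nonneg c e m)),
      integral_eq_setIntegral_mul_inverseLaplaceSeries hν hb ha hL (continuous_bumpIoo c e m)
        (abs_bumpIoo_le c e m) hm (fun y => bumpIoo_eq_zero m),
      ofReal_integral_eq_lintegral_ofReal hi]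
    · refine setLIntegral_eq_of_subset_of_forall_notMem_eq_zero measurableSet_Icc
        measurableSet_Ioi (fun y hy => hm.trans_le hy.1) (fun y hy => ?_)
      rw [bumpIoo_eq_zero m hy, zero_mul, ENNReal.ofReal_zero]
    · filter_upwards [ae_restrict_mem measurableSet_Icc] with y hy
      exact mul_nonneg (bumpIoo_nonneg c e m y)
        (inverseLaplaceSeries_nonneg hν hb ha hL (hm.trans_le hy.1))
  have h := tendsto_nhds_unique hl (hr.congr fun m => (heq m).symm)
  have h1 : ∫⁻ u, ENNReal.ofReal ((Set.Ioo c e).indicator 1 u) ∂ν = ν (Set.Ioo c e) := by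
    rw [← lintegral_indicator_one measurableSet_Ioo]
    refine lintegral_congr fun u => ?_
    by_cases hu : u ∈ Set.Ioo c e <;> simp [hu]
  have h2 : ∫⁻ y in Set.Ioi 0,
      ENNReal.ofReal ((Set.Ioo c e).indicator 1 y * inverseLaplaceSeries a b y) =
      ∫⁻ y in Set.Ioo c e, ENNReal.ofReal (inverseLaplaceSeries a b y) := by
    rw [← setLIntegral_eq_of_subset_of_forall_notMem_eq_zero
      (s := Set.Ioo c e) measurableSet_Ioo measurableSet_Ioi (fun y hy => hc.trans_lt hy.1)
      (fun y hy => by rw [Set.indicator_of_notMem hy, zero_mul, ENNReal.ofReal_zero])]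
    refine setLIntegral_congr_fun measurableSet_Ioo fun y hy => ?_
    simp [hy]
  rw [← h1, h, h2]

theorem measure_inter_Ioi_eq_ofReal_integral {s : Set ℝ} (hs : MeasurableSet s) :
    ν (s ∩ Set.Ioi 0) = ENNReal.ofReal (∫ y in s ∩ Set.Ioi 0, inverseLaplaceSeries a b y) := by
  have heq : ν.restrict (Set.Ioi 0) = (volume.restrict (Set.Ioi 0)).withDensity
      fun y => ENNReal.ofReal (inverseLaplaceSeries a b y) := by
    refine Real.measure_ext_Ioo_rat fun c e => ?_
    have hI : Set.Ioo (c : ℝ) e ∩ Set.Ioi 0 = Set.Ioo (max (c : ℝ) 0) e := by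
      ext y
      simp only [Set.mem_inter_iff, Set.mem_Ioo, Set.mem_Ioi, max_lt_iff]
      tauto
    rw [Measure.restrict_apply measurableSet_Ioo, withDensity_apply _ measurableSet_Ioo,
      Measure.restrict_restrict measurableSet_Ioo, hI]
    exact measure_Ioo_eq_lintegral_inverseLaplaceSeries hν hb ha hL (le_max_right _ _)
  have hms := hs.inter (measurableSet_Ioi : MeasurableSet (Set.Ioi (0 : ℝ)))
  have h1 : ν (s ∩ Set.Ioi 0) =
      ∫⁻ y in s ∩ Set.Ioi 0, ENNReal.ofReal (inverseLaplaceSeries a b y) := by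
    rw [← Measure.restrict_apply hs, heq, withDensity_apply _ hs, Measure.restrict_restrict hs]
  have hnn : 0 ≤ᵐ[volume.restrict (s ∩ Set.Ioi 0)] inverseLaplaceSeries a b := by
    filter_upwards [ae_restrict_mem hms] with y hy
    exact inverseLaplaceSeries_nonneg hν hb ha hL hy.2
  rw [h1, ofReal_integral_eq_lintegral_ofReal _ hnn]
  refine ⟨(measurable_inverseLaplaceSeries a b).aestronglyMeasurable, ?_⟩
  rw [hasFiniteIntegral_iff_ofReal hnn, ← h1]
  exact measure_lt_top _ _

end Inversion

theorem measurable_real_sign : Measurable Real.sign :=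
  Measurable.ite measurableSet_Iio measurable_const
    (Measurable.ite measurableSet_Ioi measurable_const measurable_const)

theorem sign_mul_of_pos {r : ℝ} (hr : 0 < r) (x : ℝ) : Real.sign (r * x) = Real.sign x := by
  rcases lt_trichotomy x 0 with h | rfl | h
  · rw [Real.sign_of_neg h, Real.sign_of_neg (mul_neg_of_pos_of_neg hr h)]
  · rw [mul_zero]
  · rw [Real.sign_of_pos h, Real.sign_of_pos (mul_pos hr h)]

section CharExp

variable {d : ℕ} {α : ℝ} (Λ : Measure (Sph d))

/-- The integrand of the characteristic exponent. -/
def charExpIntegrand (d : ℕ) (α : ℝ) (z : Ed d) (v : Sph d) : ℂ :=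
  (|⟪z, (v : Ed d)⟫| ^ α : ℝ) *
    (1 - Complex.I * (Real.tan (Real.pi * α / 2) : ℂ) * (Real.sign ⟪z, (v : Ed d)⟫ : ℂ))

theorem charExp_eq_integral (z : Ed d) :
    charExp d α Λ z = ∫ v, charExpIntegrand d α z v ∂Λ := rfl

theorem re_charExpIntegrand (z : Ed d) (v : Sph d) :
    (charExpIntegrand d α z v).re = |⟪z, (v : Ed d)⟫| ^ α := by
  rw [charExpIntegrand]
  generalize Real.tan (Real.pi * α / 2) = T
  simp

theorem charExpIntegrand_neg (z : Ed d) (v : Sph d) :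
    charExpIntegrand d α (-z) v = starRingEnd ℂ (charExpIntegrand d α z v) := by
  rw [charExpIntegrand, charExpIntegrand, inner_neg_left, Real.sign_neg, abs_neg]
  generalize Real.tan (Real.pi * α / 2) = T
  simp

theorem measurable_charExpIntegrand :
    Measurable (Function.uncurry (charExpIntegrand d α)) := by
  have hin : Measurable fun p : Ed d × Sph d => ⟪p.1, (p.2 : Ed d)⟫ :=
    (continuous_fst.inner (continuous_subtype_val.comp continuous_snd)).measurable
  have hs := Complex.measurable_ofReal.comp (measurable_real_sign.comp hin)
  have ha := Complex.measurable_ofReal.comp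
    ((continuous_abs.measurable.comp hin).pow_const α)
  exact ha.mul (measurable_const.sub (measurable_const.mul hs))

theorem norm_charExpIntegrand_le (hα : 0 < α) (z : Ed d) (v : Sph d) :
    ‖charExpIntegrand d α z v‖ ≤ ‖z‖ ^ α * (1 + |Real.tan (Real.pi * α / 2)|) := by
  have hv : ‖(v : Ed d)‖ = 1 := norm_eq_of_mem_sphere v
  have h1 : |⟪z, (v : Ed d)⟫| ≤ ‖z‖ := by
    simpa [hv] using abs_real_inner_le_norm z (v : Ed d)
  have h2 : |Real.sign ⟪z, (v : Ed d)⟫| ≤ 1 := by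
    rcases Real.sign_apply_eq ⟪z, (v : Ed d)⟫ with h | h | h <;> simp [h]
  rw [charExpIntegrand, norm_mul, Complex.norm_real, Real.norm_eq_abs,
    abs_of_nonneg (Real.rpow_nonneg (abs_nonneg _) _)]
  refine mul_le_mul (Real.rpow_le_rpow (abs_nonneg _) h1 hα.le) ?_ (norm_nonneg _)
    (Real.rpow_nonneg (norm_nonneg _) _)
  refine (norm_sub_le _ _).trans ?_
  rw [norm_one, norm_mul, norm_mul, Complex.norm_I, one_mul, Complex.norm_real, Complex.norm_real,
    Real.norm_eq_abs, Real.norm_eq_abs]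
  gcongr
  exact mul_le_of_le_one_right (abs_nonneg _) h2

variable [IsFiniteMeasure Λ]

theorem integrable_charExpIntegrand (hα : 0 < α) (z : Ed d) :
    Integrable (charExpIntegrand d α z) Λ :=
  Integrable.of_bound (measurable_charExpIntegrand.of_uncurry_left).aestronglyMeasurable _
    (Filter.Eventually.of_forall (norm_charExpIntegrand_le hα z))

theorem measurable_charExp : Measurable (charExp d α Λ) :=
  (StronglyMeasurable.integral_prod_right
    (measurable_charExpIntegrand (d := d) (α := α)).stronglyMeasurable).measurable

theorem exists_norm_charExp_le (hα : 0 < α) :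
    ∃ M, 0 < M ∧ ∀ z : Ed d, ‖charExp d α Λ z‖ ≤ M * ‖z‖ ^ α := by
  refine ⟨(1 + |Real.tan (Real.pi * α / 2)|) * (Λ.real Set.univ + 1), by positivity, fun z => ?_⟩
  have h := norm_integral_le_of_norm_le_const (μ := Λ)
    (Filter.Eventually.of_forall (norm_charExpIntegrand_le hα z))
  rw [charExp_eq_integral]
  refine h.trans ?_
  have : 0 ≤ ‖z‖ ^ α * (1 + |Real.tan (Real.pi * α / 2)|) := by positivity
  nlinarith

omit [IsFiniteMeasure Λ] in
theorem charExp_smul {r : ℝ} (hr : 0 < r) (z : Ed d) :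
    charExp d α Λ (r • z) = (r ^ α : ℝ) * charExp d α Λ z := by
  rw [charExp_eq_integral, charExp_eq_integral, ← integral_const_mul]
  refine integral_congr_ae (Filter.Eventually.of_forall fun v => ?_)
  simp only [charExpIntegrand]
  rw [real_inner_smul_left, sign_mul_of_pos hr, abs_mul, abs_of_pos hr,
    Real.mul_rpow hr.le (abs_nonneg _)]
  push_cast
  ring

omit [IsFiniteMeasure Λ] in
theorem charExp_neg (z : Ed d) :
    charExp d α Λ (-z) = starRingEnd ℂ (charExp d α Λ z) := by
  rw [charExp_eq_integral, charExp_eq_integral, ← integral_conj]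
  refine integral_congr_ae (Filter.Eventually.of_forall fun v => ?_)
  exact charExpIntegrand_neg z v

theorem re_charExp (hα : 0 < α) (z : Ed d) :
    (charExp d α Λ z).re = ∫ v, |⟪z, (v : Ed d)⟫| ^ α ∂Λ := by
  rw [charExp_eq_integral, ← RCLike.re_eq_complex_re,
    ← integral_re (integrable_charExpIntegrand Λ hα z)]
  refine integral_congr_ae (Filter.Eventually.of_forall fun v => ?_)
  exact re_charExpIntegrand z v

theorem re_charExp_nonneg (hα : 0 < α) (z : Ed d) : 0 ≤ (charExp d α Λ z).re := by
  rw [re_charExp Λ hα]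
  exact integral_nonneg fun v => by positivity

theorem ae_re_charExp_pos (hα : 0 < α) (hΛ : Λ ≠ 0) :
    ∀ᵐ z : Ed d, 0 < (charExp d α Λ z).re := by
  let W : Submodule ℝ (Ed d) :=
    { carrier := {z | ∀ᵐ v : Sph d ∂Λ, ⟪z, (v : Ed d)⟫ = 0}
      add_mem' := fun {x y} hx hy => by
        rw [Set.mem_ofPred_eq] at hx hy ⊢
        filter_upwards [hx, hy] with v h1 h2
        rw [inner_add_left, h1, h2, add_zero]
      zero_mem' := by
        rw [Set.mem_ofPred_eq]
        exact Filter.Eventually.of_forall fun v => inner_zero_left _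
      smul_mem' := fun c x hx => by
        rw [Set.mem_ofPred_eq] at hx ⊢
        filter_upwards [hx] with v h1
        rw [real_inner_smul_left, h1, mul_zero] }
  have hW : W ≠ ⊤ := fun h => by
    have h1 : ∀ᵐ v : Sph d ∂Λ, ∀ i : Fin d, ⟪EuclideanSpace.single i (1 : ℝ), (v : Ed d)⟫ = 0 :=
      ae_all_iff.2 fun i => by
        have : EuclideanSpace.single i (1 : ℝ) ∈ W := h ▸ Submodule.mem_top
        exact this
    have : (ae Λ).NeBot := ae_neBot.2 hΛ
    obtain ⟨v, hv⟩ := h1.exists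
    have hv0 : (v : Ed d) = 0 := by
      ext i
      simpa [EuclideanSpace.inner_single_left] using hv i
    have hv1 : ‖(v : Ed d)‖ = 1 := norm_eq_of_mem_sphere v
    rw [hv0, norm_zero] at hv1
    exact zero_ne_one hv1
  have hnull : volume (W : Set (Ed d)) = 0 := Measure.addHaar_submodule volume W hW
  filter_upwards [measure_eq_zero_iff_ae_notMem.1 hnull] with z hz
  refine lt_of_le_of_ne (re_charExp_nonneg Λ hα z) fun h0 => hz ?_
  rw [re_charExp Λ hα] at h0
  have hi : Integrable (fun v : Sph d => |⟪z, (v : Ed d)⟫| ^ α) Λ := by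
    have := (integrable_charExpIntegrand Λ hα z).re
    exact this.congr (Filter.Eventually.of_forall fun v => re_charExpIntegrand z v)
  have h1 := (integral_eq_zero_iff_of_nonneg (fun v => by positivity) hi).1 h0.symm
  change ∀ᵐ v : Sph d ∂Λ, ⟪z, (v : Ed d)⟫ = 0
  filter_upwards [h1] with v hv
  exact abs_eq_zero.1 ((Real.rpow_eq_zero (abs_nonneg _) hα.ne').1 hv)

end CharExp

instance (d : ℕ) : IsFiniteMeasure (ωd d) :=
  inferInstanceAs (IsFiniteMeasure (volume : Measure (Ed d)).toSphere)

section Polar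

variable {d : ℕ}

theorem integral_eq_integral_Ioi_mul_integral_sphere {𝕜 : Type*} [RCLike 𝕜] {f : Ed d → 𝕜}
    {g : ℝ → 𝕜} {h : Sph d → 𝕜} (hd : 2 ≤ d)
    (hf : ∀ (ρ : ℝ), 0 < ρ → ∀ u : Sph d, f (ρ • (u : Ed d)) = g ρ * h u) :
    ∫ z, f z = (∫ ρ in Set.Ioi (0 : ℝ), ρ ^ (d - 1) • g ρ) * ∫ u, h u ∂ωd d := by
  have : Nonempty (Fin d) := ⟨⟨0, by omega⟩⟩
  have h1 : ∫ z, f z = ∫ x : ({0}ᶜ : Set (Ed d)), f x ∂((volume : Measure (Ed d)).comap (↑)) := by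
    rw [integral_subtype_comap (measurableSet_singleton _).compl f, restrict_compl_singleton]
  have h2 : ∫ x : ({0}ᶜ : Set (Ed d)), f x ∂((volume : Measure (Ed d)).comap (↑)) =
      ∫ x : Sph d × Set.Ioi (0 : ℝ), h x.1 * g x.2
        ∂((ωd d).prod (Measure.volumeIoiPow (Module.finrank ℝ (Ed d) - 1))) := by
    rw [ωd, ← (volume : Measure (Ed d)).measurePreserving_homeomorphUnitSphereProd.integral_comp
      (Homeomorph.measurableEmbedding _)]
    refine integral_congr_ae (Filter.Eventually.of_forall fun x => ?_)
    have hx : (x : Ed d) ≠ 0 := x.2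
    have hn : 0 < ‖(x : Ed d)‖ := norm_pos_iff.2 hx
    have h3 := hf ‖(x : Ed d)‖ hn ((homeomorphUnitSphereProd (Ed d)) x).1
    rw [homeomorphUnitSphereProd_apply_fst_coe, smul_inv_smul₀ hn.ne'] at h3
    simp only [homeomorphUnitSphereProd_apply_snd_coe]
    rw [h3, mul_comm]
  rw [h1, h2, integral_prod_mul h (fun ρ : Set.Ioi (0 : ℝ) => g ρ), mul_comm]
  congr 1
  simp only [Measure.volumeIoiPow, ENNReal.ofReal]
  rw [integral_withDensity_eq_integral_smul,
    integral_subtype_comap measurableSet_Ioi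
      fun a => Real.toNNReal (a ^ (Module.finrank ℝ (Ed d) - 1)) • g a, finrank_euclideanSpace_fin]
  · refine setIntegral_congr_fun measurableSet_Ioi fun x hx => ?_
    have hx0 : 0 < x := hx
    simp only [NNReal.smul_def]
    rw [Real.coe_toNNReal _ (pow_nonneg hx0.le _)]
  · exact (measurable_subtype_coe.pow_const _).real_toNNReal

theorem integral_Ioi_pow_mul_exp_mul_rpow (hd : 2 ≤ d) {β : ℝ} (hβ : 0 ≤ β) :
    ∫ ρ in Set.Ioi (0 : ℝ), ρ ^ (d - 1) * (Real.exp (-(1 / 4) * ρ ^ 2) * ρ ^ β) =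
      2 ^ (β + d - 1) * Real.Gamma ((β + d) / 2) := by
  have hd' : (2 : ℝ) ≤ d := by exact_mod_cast hd
  have h := integral_rpow_mul_exp_neg_mul_rpow (p := 2) (q := β + d - 1) (b := 1 / 4) two_pos
    (by linarith) (by norm_num)
  have h2 : ((1 : ℝ) / 4) ^ (-(β + d - 1 + 1) / 2) * (1 / 2) = 2 ^ (β + d - 1) := by
    rw [show (1 : ℝ) / 4 = 2 ^ (-2 : ℝ) by rw [Real.rpow_neg two_pos.le]; norm_num,
      ← Real.rpow_mul two_pos.le, Real.rpow_sub_one two_ne_zero]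
    ring_nf
  rw [h2, sub_add_cancel] at h
  rw [← h]
  refine setIntegral_congr_fun measurableSet_Ioi fun x hx => ?_
  have hx0 : 0 < x := hx
  rw [show β + d - 1 = ((d - 1 : ℕ) : ℝ) + β by
      rw [Nat.cast_sub (by omega)]; push_cast; ring, Real.rpow_add hx0, Real.rpow_natCast,
    Real.rpow_two]
  ring

theorem integrable_exp_mul_norm_rpow (hd : 2 ≤ d) {β : ℝ} (hβ : 0 ≤ β) :
    Integrable fun z : Ed d => Real.exp (-(1 / 4) * ‖z‖ ^ 2) * ‖z‖ ^ β := by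
  have : Nonempty (Fin d) := ⟨⟨0, by omega⟩⟩
  have hd' : (2 : ℝ) ≤ d := by exact_mod_cast hd
  rw [integrable_fun_norm_addHaar volume (f := fun ρ => Real.exp (-(1 / 4) * ρ ^ 2) * ρ ^ β),
    finrank_euclideanSpace_fin]
  refine IntegrableOn.congr_fun (integrableOn_rpow_mul_exp_neg_mul_rpow (p := 2)
    (s := β + d - 1) (b := 1 / 4) (by linarith) two_pos (by norm_num)) (fun x hx => ?_)
    measurableSet_Ioi
  have hx0 : 0 < x := hx
  rw [show β + d - 1 = ((d - 1 : ℕ) : ℝ) + β by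
      rw [Nat.cast_sub (by omega)]; push_cast; ring, Real.rpow_add hx0, Real.rpow_natCast,
    Real.rpow_two, smul_eq_mul]
  ring

theorem integral_exp_mul_norm_rpow (hd : 2 ≤ d) {β : ℝ} (hβ : 0 ≤ β) :
    ∫ z : Ed d, Real.exp (-(1 / 4) * ‖z‖ ^ 2) * ‖z‖ ^ β =
      2 ^ (β + d - 1) * Real.Gamma ((β + d) / 2) * (ωd d).real Set.univ := by
  rw [integral_eq_integral_Ioi_mul_integral_sphere
    (g := fun ρ => Real.exp (-(1 / 4) * ρ ^ 2) * ρ ^ β) (h := fun _ => 1) hd]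
  · simp only [smul_eq_mul]
    rw [integral_Ioi_pow_mul_exp_mul_rpow hd hβ]
    simp
  · intro ρ hρ u
    have hu : ‖(u : Ed d)‖ = 1 := norm_eq_of_mem_sphere u
    rw [norm_smul, hu, Real.norm_of_nonneg hρ.le, mul_one, mul_one]

variable {α : ℝ} (Λ : Measure (Sph d))

theorem integral_exp_mul_charExp_pow (hd : 2 ≤ d) (hα : 0 < α) (k : ℕ) :
    ∫ z : Ed d, (Real.exp (-(1 / 4) * ‖z‖ ^ 2) : ℂ) * charExp d α Λ z ^ k =
      ((2 ^ ((k : ℝ) * α + d - 1) * Real.Gamma (((k : ℝ) * α + d) / 2) : ℝ) : ℂ) *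
        ∫ u, Vfun d α Λ u ^ k ∂ωd d := by
  rw [integral_eq_integral_Ioi_mul_integral_sphere
    (g := fun ρ => ((Real.exp (-(1 / 4) * ρ ^ 2) * ρ ^ ((k : ℝ) * α) : ℝ) : ℂ))
    (h := fun u => Vfun d α Λ u ^ k) hd]
  · congr 1
    rw [← integral_Ioi_pow_mul_exp_mul_rpow hd (by positivity), ← integral_complex_ofReal]
    refine integral_congr_ae (Filter.Eventually.of_forall fun ρ => ?_)
    simp
  · intro ρ hρ u
    have hu : ‖(u : Ed d)‖ = 1 := norm_eq_of_mem_sphere u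
    rw [norm_smul, hu, Real.norm_of_nonneg hρ.le, mul_one, charExp_smul Λ hρ, Vfun, mul_pow,
      mul_comm (k : ℝ) α, Real.rpow_mul_natCast hρ.le]
    push_cast
    ring

theorem im_integral_Vfun_pow (hd : 2 ≤ d) (hα : 0 < α) (k : ℕ) :
    (∫ u, Vfun d α Λ u ^ k ∂ωd d).im = 0 := by
  have hd' : (2 : ℝ) ≤ d := by exact_mod_cast hd
  have hc : (2 ^ ((k : ℝ) * α + d - 1) * Real.Gamma (((k : ℝ) * α + d) / 2) : ℝ) ≠ 0 :=
    (mul_pos (by positivity) (Real.Gamma_pos_of_pos (by positivity))).ne'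
  have h := integral_exp_mul_charExp_pow Λ hd hα k
  have hr : starRingEnd ℂ (∫ z : Ed d, (Real.exp (-(1 / 4) * ‖z‖ ^ 2) : ℂ) *
      charExp d α Λ z ^ k) = ∫ z : Ed d, (Real.exp (-(1 / 4) * ‖z‖ ^ 2) : ℂ) *
      charExp d α Λ z ^ k := by
    rw [← integral_conj, ← integral_neg_eq_self]
    refine integral_congr_ae (Filter.Eventually.of_forall fun z => ?_)
    simp only
    rw [map_mul, map_pow, ← charExp_neg, neg_neg, norm_neg, Complex.conj_ofReal]
  rw [Complex.conj_eq_iff_im, h, Complex.im_ofReal_mul] at hr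
  exact (mul_eq_zero.1 hr).resolve_left hc

/-- The coefficients in the expansion `E exp (-t |X|²) = ∑ a_k t ^ (k α / 2)`. -/
def laplaceCoeff (d : ℕ) (α : ℝ) (Λ : Measure (Sph d)) (k : ℕ) : ℝ :=
  (-1) ^ k / (Nat.factorial k : ℝ) * (Real.pi ^ (-(d : ℝ) / 2) * 2 ^ ((k : ℝ) * α - 1) *
    Real.Gamma (((k : ℝ) * α + d) / 2)) * (∫ u, Vfun d α Λ u ^ k ∂ωd d).re

variable [IsFiniteMeasure Λ]

theorem summable_laplaceCoeff (hd : 2 ≤ d) (hα0 : 0 < α) (hα1 : α < 1) {R : ℝ} (hR : 0 < R) :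
    Summable fun k : ℕ => |laplaceCoeff d α Λ k| * Real.Gamma (k * (α / 2) + 2) * R ^ k := by
  have hd' : (2 : ℝ) ≤ d := by exact_mod_cast hd
  obtain ⟨M, hM, hΦ⟩ := exists_norm_charExp_le (d := d) Λ hα0
  have hV : ∀ u : Sph d, ‖Vfun d α Λ u‖ ≤ M := fun u => by
    have hu : ‖(u : Ed d)‖ = 1 := norm_eq_of_mem_sphere u
    simpa [Vfun, hu] using hΦ u
  have hI : ∀ k : ℕ, |(∫ u, Vfun d α Λ u ^ k ∂ωd d).re| ≤ M ^ k * (ωd d).real Set.univ :=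
    fun k => (Complex.abs_re_le_norm _).trans (norm_integral_le_of_norm_le_const
      (Filter.Eventually.of_forall fun u => by
        rw [norm_pow]; exact pow_le_pow_left₀ (norm_nonneg _) (hV u) k))
  have hs := (summable_Gamma_mul_Gamma_mul_pow_div_factorial (b := α / 2) (D := (d : ℝ) / 2)
    (D' := 2) (R := 2 ^ α * M * R) (by positivity) (by linarith) (by positivity) two_pos
    (by positivity)).mul_left (Real.pi ^ (-(d : ℝ) / 2) / 2 * (ωd d).real Set.univ)
  refine Summable.of_nonneg_of_le (fun k => ?_) (fun k => ?_) hs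
  · have : 0 < Real.Gamma (k * (α / 2) + 2) := Real.Gamma_pos_of_pos (by positivity)
    positivity
  · have h1 : 0 < Real.Gamma (k * (α / 2) + 2) := Real.Gamma_pos_of_pos (by positivity)
    have h2 : 0 < Real.Gamma (((k : ℝ) * α + d) / 2) := Real.Gamma_pos_of_pos (by positivity)
    have h3 : (2 : ℝ) ^ ((k : ℝ) * α - 1) = (2 ^ α) ^ k / 2 := by
      rw [Real.rpow_sub_one two_ne_zero, mul_comm (k : ℝ) α, Real.rpow_mul_natCast two_pos.le]
    have h4 : ((k : ℝ) * (α / 2) + d / 2) = (k * α + d) / 2 := by ring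
    rw [laplaceCoeff, abs_mul, abs_mul, abs_div, abs_pow, abs_neg, abs_one, one_pow, Nat.abs_cast,
      abs_of_pos (show 0 < Real.pi ^ (-(d : ℝ) / 2) * 2 ^ ((k : ℝ) * α - 1) *
        Real.Gamma (((k : ℝ) * α + d) / 2) by positivity), h3, h4]
    calc _ ≤ 1 / (Nat.factorial k : ℝ) * (Real.pi ^ (-(d : ℝ) / 2) * ((2 ^ α) ^ k / 2) *
        Real.Gamma (((k : ℝ) * α + d) / 2)) * (M ^ k * (ωd d).real Set.univ) *
          Real.Gamma (k * (α / 2) + 2) * R ^ k := by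
          gcongr
          exact hI k
      _ = _ := by
        rw [mul_pow, mul_pow]
        ring

end Polar

section GaussianTransform

variable {d : ℕ} {α : ℝ}

theorem integral_exp_mul_cexp_inner {t : ℝ} (ht : 0 < t) (x : Ed d) :
    ∫ z : Ed d, (Real.exp (-(1 / 4) * ‖z‖ ^ 2) : ℂ) *
        Complex.exp (Complex.I * (⟪√t • z, x⟫ : ℂ)) =
      ((((4 * Real.pi) ^ ((d : ℝ) / 2) * Real.exp (-t * ‖x‖ ^ 2) : ℝ)) : ℂ) := by
  have h := GaussianFourier.integral_cexp_neg_mul_sq_norm_add (b := 1 / 4) (by norm_num)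
    Complex.I (√t • x)
  have h1 : ∀ z : Ed d, Complex.exp (-(1 / 4) * ‖z‖ ^ 2 + Complex.I * (⟪√t • x, z⟫ : ℂ)) =
      (Real.exp (-(1 / 4) * ‖z‖ ^ 2) : ℂ) * Complex.exp (Complex.I * (⟪√t • z, x⟫ : ℂ)) :=
    fun z => by
      rw [Complex.exp_add, real_inner_smul_left, real_inner_smul_left, real_inner_comm]
      push_cast
      rfl
  rw [integral_congr_ae (Filter.Eventually.of_forall h1)] at h
  rw [h, finrank_euclideanSpace_fin, norm_smul, Real.norm_of_nonneg (Real.sqrt_nonneg _)]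
  push_cast
  rw [Complex.ofReal_cpow (by positivity), mul_pow, ← Complex.ofReal_pow √t, Real.sq_sqrt ht.le,
    Complex.I_sq]
  push_cast
  congr 2
  · ring_nf
  · ring

variable (Λ : Measure (Sph d)) (μ : Measure (Ed d)) [IsProbabilityMeasure μ]

theorem integrable_exp_neg_mul_norm_sq {b : ℝ} (hb : 0 < b) :
    Integrable fun z : Ed d => Real.exp (-b * ‖z‖ ^ 2) := by
  have h := (GaussianFourier.integrable_cexp_neg_mul_sq_norm_add (V := Ed d) (b := b)
    (by simpa using hb) 0 0).norm
  refine h.congr (Filter.Eventually.of_forall fun z => ?_)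
  simp [Complex.norm_exp, ← Complex.ofReal_pow]

theorem integral_exp_neg_mul_norm_sq_eq (hμ : IsStableChar d α Λ μ) {t : ℝ} (ht : 0 < t) :
    ((∫ x, Real.exp (-t * ‖x‖ ^ 2) ∂μ : ℝ) : ℂ) =
      ((4 * Real.pi) ^ (-((d : ℝ) / 2)) : ℝ) *
        ∫ z : Ed d, (Real.exp (-(1 / 4) * ‖z‖ ^ 2) : ℂ) *
          Complex.exp (-((t ^ (α / 2) : ℝ) * charExp d α Λ z)) := by
  have hπ : (0 : ℝ) < (4 * Real.pi) ^ ((d : ℝ) / 2) := by positivity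
  have hint : Integrable (Function.uncurry fun (x z : Ed d) =>
      (Real.exp (-(1 / 4) * ‖z‖ ^ 2) : ℂ) * Complex.exp (Complex.I * (⟪√t • z, x⟫ : ℂ)))
      (μ.prod volume) := by
    have h1 : Integrable (fun p : Ed d × Ed d => Real.exp (-(1 / 4) * ‖p.2‖ ^ 2))
        (μ.prod volume) :=
      (integrable_exp_neg_mul_norm_sq (d := d) (b := 1 / 4) (by norm_num)).comp_snd μ
    refine h1.mono (by fun_prop) (Filter.Eventually.of_forall fun p => ?_)
    rw [Function.uncurry, norm_mul, mul_comm Complex.I, Complex.norm_exp_ofReal_mul_I, mul_one,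
      Complex.norm_real]
  have hswap := integral_integral_swap hint
  have hL : ∀ x : Ed d, ∫ z : Ed d, (Real.exp (-(1 / 4) * ‖z‖ ^ 2) : ℂ) *
      Complex.exp (Complex.I * (⟪√t • z, x⟫ : ℂ)) = _ := integral_exp_mul_cexp_inner ht
  have hR : ∀ z : Ed d, ∫ x, (Real.exp (-(1 / 4) * ‖z‖ ^ 2) : ℂ) *
      Complex.exp (Complex.I * (⟪√t • z, x⟫ : ℂ)) ∂μ = (Real.exp (-(1 / 4) * ‖z‖ ^ 2) : ℂ) *
          Complex.exp (-((t ^ (α / 2) : ℝ) * charExp d α Λ z)) := fun z => by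
    rw [integral_const_mul, hμ, charExp_smul Λ (Real.sqrt_pos.2 ht), Real.sqrt_eq_rpow,
      ← Real.rpow_mul ht.le, one_div_mul_eq_div]
  simp only [hL, hR] at hswap
  rw [← hswap, integral_complex_ofReal, ← Complex.ofReal_mul, integral_const_mul, ← mul_assoc,
    Real.rpow_neg (by positivity), inv_mul_cancel₀ hπ.ne', one_mul]

variable [IsFiniteMeasure Λ]

theorem integrable_exp_mul_charExp_pow (hd : 2 ≤ d) (hα : 0 < α) (k : ℕ) :
    Integrable fun z : Ed d => (Real.exp (-(1 / 4) * ‖z‖ ^ 2) : ℂ) * charExp d α Λ z ^ k := by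
  obtain ⟨M, hM, hΦ⟩ := exists_norm_charExp_le (d := d) Λ hα
  refine ((integrable_exp_mul_norm_rpow (d := d) (β := α * k) hd (by positivity)).const_mul
    (M ^ k)).mono' ?_ (Filter.Eventually.of_forall fun z => ?_)
  · exact (by fun_prop : Measurable fun z : Ed d => (Real.exp (-(1 / 4) * ‖z‖ ^ 2) : ℂ)).mul
      ((measurable_charExp Λ).pow_const k) |>.aestronglyMeasurable
  · rw [norm_mul, norm_pow, Complex.norm_real, Real.norm_of_nonneg (Real.exp_pos _).le,
      Real.rpow_mul_natCast (norm_nonneg _)]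
    calc _ ≤ Real.exp (-(1 / 4) * ‖z‖ ^ 2) * (M * ‖z‖ ^ α) ^ k := by gcongr; exact hΦ z
      _ = _ := by rw [mul_pow]; ring

theorem integral_norm_exp_mul_charExp_pow_le (hd : 2 ≤ d) (hα : 0 < α) {M : ℝ}
    (hΦ : ∀ z : Ed d, ‖charExp d α Λ z‖ ≤ M * ‖z‖ ^ α) (k : ℕ) :
    ∫ z : Ed d, ‖(Real.exp (-(1 / 4) * ‖z‖ ^ 2) : ℂ) * charExp d α Λ z ^ k‖ ≤
      M ^ k * (2 ^ (α * k + d - 1) * Real.Gamma ((α * k + d) / 2) * (ωd d).real Set.univ) := by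
  rw [← integral_exp_mul_norm_rpow hd (by positivity), ← integral_const_mul]
  refine integral_mono (integrable_exp_mul_charExp_pow Λ hd hα k).norm
    ((integrable_exp_mul_norm_rpow hd (by positivity)).const_mul _) fun z => ?_
  simp only
  rw [norm_mul, norm_pow, Complex.norm_real, Real.norm_of_nonneg (Real.exp_pos _).le,
    Real.rpow_mul_natCast (norm_nonneg _)]
  calc _ ≤ Real.exp (-(1 / 4) * ‖z‖ ^ 2) * (M * ‖z‖ ^ α) ^ k := by gcongr; exact hΦ z
    _ = _ := by rw [mul_pow]; ring

theorem integral_exp_mul_cexp_neg_mul_charExp (hd : 2 ≤ d) (hα0 : 0 < α) (hα1 : α < 1) {s : ℝ}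
    (hs : 0 < s) :
    ∫ z : Ed d, (Real.exp (-(1 / 4) * ‖z‖ ^ 2) : ℂ) * Complex.exp (-(s * charExp d α Λ z)) =
      ∑' k : ℕ, (((-s) ^ k / (Nat.factorial k : ℝ) : ℝ) : ℂ) *
        ∫ z : Ed d, (Real.exp (-(1 / 4) * ‖z‖ ^ 2) : ℂ) * charExp d α Λ z ^ k := by
  obtain ⟨M, hM, hΦ⟩ := exists_norm_charExp_le (d := d) Λ hα0
  have hd' : (2 : ℝ) ≤ d := by exact_mod_cast hd
  have h := hasSum_integral_of_summable_integral_norm (μ := (volume : Measure (Ed d)))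
    (F := fun (k : ℕ) z => (((-s) ^ k / (Nat.factorial k : ℝ) : ℝ) : ℂ) *
      ((Real.exp (-(1 / 4) * ‖z‖ ^ 2) : ℂ) * charExp d α Λ z ^ k))
    (fun k => (integrable_exp_mul_charExp_pow Λ hd hα0 k).const_mul _) ?_
  · simp only [integral_const_mul] at h
    rw [h.tsum_eq]
    refine integral_congr_ae (Filter.Eventually.of_forall fun z => ?_)
    simp only
    rw [Complex.exp_eq_exp_ℂ, NormedSpace.exp_eq_tsum_div, ← tsum_mul_left]
    refine tsum_congr fun k => ?_
    push_cast
    rw [neg_pow (_ * _), neg_pow (s : ℂ), mul_pow]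
    ring
  · simp only [norm_mul (Complex.ofReal _ : ℂ), integral_const_mul]
    have hs := (summable_Gamma_mul_Gamma_mul_pow_div_factorial (b := α / 2) (D := (d : ℝ) / 2)
      (D' := 2) (R := 2 ^ α * M * s) (by positivity) (by linarith) (by positivity) two_pos
      (by positivity)).mul_left (2 ^ ((d : ℝ) - 1) * (ωd d).real Set.univ)
    refine Summable.of_nonneg_of_le (fun k => by positivity) (fun k => ?_) hs
    have h1 : 1 ≤ Real.Gamma (k * (α / 2) + 2) := by
      rw [← Real.Gamma_two]
      exact Real.Gamma_strictMonoOn_Ici.monotoneOn (by simp) (by simp; positivity)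
        (by simp; positivity)
    have h2 : 0 < Real.Gamma ((α * k + d) / 2) := Real.Gamma_pos_of_pos (by positivity)
    have h3 : (2 : ℝ) ^ (α * k + d - 1) = (2 ^ α) ^ k * 2 ^ ((d : ℝ) - 1) := by
      rw [add_sub_assoc, Real.rpow_add two_pos, Real.rpow_mul_natCast two_pos.le]
    have h4 : ((k : ℝ) * (α / 2) + d / 2) = (α * k + d) / 2 := by ring
    have h5 := integral_norm_exp_mul_charExp_pow_le Λ hd hα0 hΦ k
    simp only [norm_mul] at h5
    rw [Complex.norm_real, norm_div, norm_pow, norm_neg, Real.norm_natCast,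
      Real.norm_of_nonneg ‹0 < s›.le, h4]
    calc _ ≤ s ^ k / (Nat.factorial k : ℝ) * (M ^ k * ((2 ^ α) ^ k * 2 ^ ((d : ℝ) - 1) *
          Real.Gamma ((α * k + d) / 2) * (ωd d).real Set.univ)) * 1 := by
          rw [mul_one, ← h3]
          gcongr
      _ ≤ s ^ k / (Nat.factorial k : ℝ) * (M ^ k * ((2 ^ α) ^ k * 2 ^ ((d : ℝ) - 1) *
          Real.Gamma ((α * k + d) / 2) * (ωd d).real Set.univ)) *
            Real.Gamma (k * (α / 2) + 2) := by gcongr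
      _ = _ := by
        rw [mul_pow, mul_pow]
        ring

theorem integral_exp_neg_mul_norm_sq_eq_tsum (hd : 2 ≤ d) (hα0 : 0 < α) (hα1 : α < 1)
    (hμ : IsStableChar d α Λ μ) {t : ℝ} (ht : 0 < t) :
    ∫ x, Real.exp (-t * ‖x‖ ^ 2) ∂μ =
      ∑' k : ℕ, laplaceCoeff d α Λ k * t ^ ((k : ℝ) * (α / 2)) := by
  have h := integral_exp_neg_mul_norm_sq_eq Λ μ hμ ht
  rw [integral_exp_mul_cexp_neg_mul_charExp Λ hd hα0 hα1 (by positivity), ← tsum_mul_left] at h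
  rw [← Complex.ofReal_inj, h, Complex.ofReal_tsum]
  refine tsum_congr fun k => ?_
  have him : ∫ u, Vfun d α Λ u ^ k ∂ωd d = (((∫ u, Vfun d α Λ u ^ k ∂ωd d).re : ℝ) : ℂ) :=
    Complex.ext rfl (by rw [im_integral_Vfun_pow Λ hd hα0, Complex.ofReal_im])
  rw [integral_exp_mul_charExp_pow Λ hd hα0, him]
  simp only [← Complex.ofReal_mul]
  congr 1
  have h1 : (2 : ℝ) ^ ((k : ℝ) * α + d - 1) = 2 ^ ((k : ℝ) * α - 1) * 2 ^ (d : ℝ) := by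
    rw [← Real.rpow_add two_pos]
    ring_nf
  have h2 : (4 * Real.pi) ^ (-((d : ℝ) / 2)) = (2 ^ (d : ℝ))⁻¹ * Real.pi ^ (-(d : ℝ) / 2) := by
    rw [Real.mul_rpow (by norm_num) Real.pi_pos.le, show (4 : ℝ) = 2 ^ (2 : ℝ) by norm_num,
      ← Real.rpow_mul two_pos.le, ← Real.rpow_neg two_pos.le]
    ring_nf
  have h3 : (-t ^ (α / 2)) ^ k = (-1) ^ k * t ^ ((k : ℝ) * (α / 2)) := by
    rw [neg_pow, mul_comm (k : ℝ), Real.rpow_mul_natCast ht.le]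
  have h4 : (2 : ℝ) ^ (d : ℝ) ≠ 0 := by positivity
  rw [laplaceCoeff, h1, h2, h3]
  field_simp

theorem measure_singleton_zero (hα : 0 < α) (hΛ : Λ ≠ 0) (hμ : IsStableChar d α Λ μ) :
    μ {0} = 0 := by
  have hle : ∀ n : ℕ, ((μ.real {0} : ℝ)) ≤ ∫ x, Real.exp (-((n : ℝ) + 1) * ‖x‖ ^ 2) ∂μ :=
    fun n => by
      rw [← integral_indicator_one (measurableSet_singleton _)]
      refine integral_mono ((integrable_const (1 : ℝ)).indicator (measurableSet_singleton _))
        ((integrable_const (1 : ℝ)).mono' (by fun_prop)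
          (Filter.Eventually.of_forall fun x => ?_)) fun x => ?_
      · rw [Real.norm_of_nonneg (Real.exp_pos _).le, Real.exp_le_one_iff]
        have : 0 ≤ ((n : ℝ) + 1) * ‖x‖ ^ 2 := by positivity
        linarith
      · by_cases hx : x = 0
        · simp [hx]
        · rw [Set.indicator_of_notMem (by simpa using hx)]
          exact (Real.exp_pos _).le
  have hlim : Tendsto (fun n : ℕ => ∫ z : Ed d, (Real.exp (-(1 / 4) * ‖z‖ ^ 2) : ℂ) *
      Complex.exp (-((((n : ℝ) + 1) ^ (α / 2) : ℝ) * charExp d α Λ z))) atTop (𝓝 0) := by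
    rw [← integral_zero (Ed d) ℂ (μ := volume)]
    refine tendsto_integral_of_dominated_convergence
      (fun z : Ed d => Real.exp (-(1 / 4) * ‖z‖ ^ 2)) (fun n => ?_)
      (integrable_exp_neg_mul_norm_sq (by norm_num))
      (fun n => Filter.Eventually.of_forall fun z => ?_) ?_
    · have := measurable_charExp (d := d) (α := α) Λ
      exact (by fun_prop : Measurable _).aestronglyMeasurable
    · rw [norm_mul, Complex.norm_real, Real.norm_of_nonneg (Real.exp_pos _).le, Complex.norm_exp]
      refine mul_le_of_le_one_right (Real.exp_pos _).le (Real.exp_le_one_iff.2 ?_)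
      rw [Complex.neg_re, Complex.re_ofReal_mul, neg_nonpos]
      exact mul_nonneg (by positivity) (re_charExp_nonneg Λ hα z)
    · filter_upwards [ae_re_charExp_pos Λ hα hΛ] with z hz
      rw [tendsto_zero_iff_norm_tendsto_zero]
      simp only [norm_mul, Complex.norm_exp, Complex.neg_re, Complex.re_ofReal_mul]
      rw [← mul_zero ‖(Real.exp (-(1 / 4) * ‖z‖ ^ 2) : ℂ)‖]
      refine (Real.tendsto_exp_neg_atTop_nhds_zero.comp (Tendsto.atTop_mul_const hz ?_)).const_mul _
      exact (tendsto_rpow_atTop (by positivity)).comp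
        (tendsto_atTop_add_const_right _ _ tendsto_natCast_atTop_atTop)
  have hlim' : Tendsto (fun n : ℕ => ∫ x, Real.exp (-((n : ℝ) + 1) * ‖x‖ ^ 2) ∂μ) atTop
      (𝓝 0) := by
    have h := (Complex.continuous_re.tendsto _).comp
      (hlim.const_mul (((4 * Real.pi) ^ (-((d : ℝ) / 2)) : ℝ) : ℂ))
    rw [mul_zero, Complex.zero_re] at h
    refine h.congr fun n => ?_
    rw [Function.comp_apply, ← integral_exp_neg_mul_norm_sq_eq Λ μ hμ (by positivity),
      Complex.ofReal_re]
  have h0 : μ.real {0} = 0 := le_antisymm (ge_of_tendsto' hlim' hle) measureReal_nonneg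
  exact (measureReal_eq_zero_iff (measure_ne_top _ _)).1 h0

end GaussianTransform

section Norm

variable {d : ℕ} {α : ℝ} (Λ : Measure (Sph d))

theorem radTerm_eq_ofReal (hd : 2 ≤ d) (hα : 0 < α) {r : ℝ} (hr : 0 < r) (k : ℕ) :
    radTerm d α Λ k r = ((2 * r * (laplaceCoeff d α Λ k * (r ^ 2) ^ (-((k : ℝ) * (α / 2)) - 1) *
      (1 / Real.Gamma (-((k : ℝ) * (α / 2))))) : ℝ) : ℂ) := by
  have him : ∫ u, Vfun d α Λ u ^ k ∂ωd d = (((∫ u, Vfun d α Λ u ^ k ∂ωd d).re : ℝ) : ℂ) :=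
    Complex.ext rfl (by rw [im_integral_Vfun_pow Λ hd hα, Complex.ofReal_im])
  have h1 : (r ^ 2) ^ (-((k : ℝ) * (α / 2)) - 1) = (r * r ^ ((k : ℝ) * α + 1))⁻¹ := by
    rw [← Real.rpow_natCast r 2, ← Real.rpow_mul hr.le, ← Real.rpow_one_add' hr.le (by positivity),
      ← Real.rpow_neg hr.le]
    push_cast
    ring_nf
  have h2 : (-((2 : ℝ) ^ α)) ^ k = (-1) ^ k * (2 * 2 ^ ((k : ℝ) * α - 1)) := by
    rw [neg_pow, Real.rpow_sub_one two_ne_zero, mul_comm (k : ℝ), Real.rpow_mul_natCast two_pos.le]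
    ring
  have h3 : -((k : ℝ) * (α / 2)) = -(k * α) / 2 := by ring
  rw [radTerm, him, ← Complex.ofReal_mul, laplaceCoeff, h1, h2, h3]
  congr 1
  field_simp

variable [IsFiniteMeasure Λ]

theorem tsum_radTerm_eq_ofReal (hd : 2 ≤ d) (hα0 : 0 < α) (hα1 : α < 1) {r : ℝ} (hr : 0 < r) :
    ∑' k : ℕ, radTerm d α Λ (k + 1) r =
      ((2 * r * inverseLaplaceSeries (laplaceCoeff d α Λ) (α / 2) (r ^ 2) : ℝ) : ℂ) := by
  have hs := summable_inverseLaplaceSeries (half_pos hα0)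
    (fun R hR => summable_laplaceCoeff Λ hd hα0 hα1 hR) (pow_pos hr 2)
  have h0 : Real.Gamma (-(((0 : ℕ) : ℝ) * (α / 2))) = 0 := by simp [Real.Gamma_zero]
  rw [inverseLaplaceSeries, hs.tsum_eq_zero_add, h0, div_zero, mul_zero, zero_add,
    ← tsum_mul_left, Complex.ofReal_tsum]
  exact tsum_congr fun k => radTerm_eq_ofReal Λ hd hα0 hr (k + 1)

end Norm

theorem map_norm_eq_map_norm_sq_preimage {d : ℕ} {μ : Measure (Ed d)} (hμ : μ {0} = 0) {s : Set ℝ}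
    (hs : MeasurableSet s) :
    μ.map (fun x : Ed d => ‖x‖) s =
      μ.map (fun x : Ed d => ‖x‖ ^ 2) (Real.sqrt ⁻¹' s ∩ Set.Ioi 0) := by
  rw [Measure.map_apply (by fun_prop) hs, Measure.map_apply (by fun_prop)
    ((Real.continuous_sqrt.measurable hs).inter measurableSet_Ioi)]
  refine measure_congr ?_
  have h0 : ∀ᵐ x ∂μ, x ≠ 0 := by rw [ae_iff]; simpa using hμ
  filter_upwards [h0] with x hx
  have hx' : 0 < ‖x‖ ^ 2 := by positivity
  refine propext ?_
  change ‖x‖ ∈ s ↔ √(‖x‖ ^ 2) ∈ s ∧ ‖x‖ ^ 2 ∈ Set.Ioi (0 : ℝ)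
  rw [Real.sqrt_sq (norm_nonneg x)]
  exact ⟨fun h => ⟨h, hx'⟩, fun h => h.1⟩

theorem setIntegral_sqrt_preimage_inter_Ioi (g : ℝ → ℝ) {s : Set ℝ} (hs : MeasurableSet s) :
    ∫ y in Real.sqrt ⁻¹' s ∩ Set.Ioi 0, g y = ∫ r in s ∩ Set.Ioi (0 : ℝ), 2 * r * g (r ^ 2) := by
  rw [Set.inter_comm, Set.inter_comm s,
    ← setIntegral_indicator (Real.continuous_sqrt.measurable hs), ← setIntegral_indicator hs,
    ← integral_comp_rpow_Ioi_of_pos two_pos]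
  refine setIntegral_congr_fun measurableSet_Ioi fun r hr => ?_
  have hr0 : (0 : ℝ) < r := hr
  have hmem : r ^ 2 ∈ Real.sqrt ⁻¹' s ↔ r ∈ s := by
    change √(r ^ 2) ∈ s ↔ r ∈ s
    rw [Real.sqrt_sq hr0.le]
  simp only [Real.rpow_two]
  by_cases h : r ∈ s
  · rw [Set.indicator_of_mem (hmem.2 h), Set.indicator_of_mem h]
    norm_num
  · rw [Set.indicator_of_notMem (mt hmem.1 h), Set.indicator_of_notMem h, smul_zero]

/-- Proposition: for `α ∈ (0,1)`, the p.d.f. of `|X|` with `X ∼ μ` is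
`g_{|X|}(r) = Σ_{k≥1} ((-2^α)^k π^{-d/2}/(k! r^{kα+1})) (Γ((kα+d)/2)/Γ(-kα/2)) ∫ V^k dω`. -/
theorem stmt12 (d : ℕ) (hd : 2 ≤ d) (α : ℝ) (hα0 : 0 < α) (hα1 : α < 1)
    (Λ : Measure (Sph d)) [IsFiniteMeasure Λ] (hΛ : Λ ≠ 0)
    (μ : Measure (Ed d)) [IsProbabilityMeasure μ] (hμ : IsStableChar d α Λ μ)
    (hnd : Nondegenerate d μ) :
    (∀ r : ℝ, 0 < r → (∑' k : ℕ, radTerm d α Λ (k + 1) r).im = 0) ∧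
    ∀ s : Set ℝ, MeasurableSet s →
      μ.map (fun x : Ed d => ‖x‖) s =
        ENNReal.ofReal (∫ r in s ∩ Set.Ioi 0, (∑' k : ℕ, radTerm d α Λ (k + 1) r).re) := by
  refine ⟨fun r hr => by rw [tsum_radTerm_eq_ofReal Λ hd hα0 hα1 hr, Complex.ofReal_im],
    fun s hs => ?_⟩
  have hm : Measurable fun x : Ed d => ‖x‖ ^ 2 := by fun_prop
  have hν : ∀ᵐ u ∂μ.map (fun x : Ed d => ‖x‖ ^ 2), 0 ≤ u :=
    (ae_map_iff hm.aemeasurable measurableSet_Ici).2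
      (Filter.Eventually.of_forall fun x => sq_nonneg ‖x‖)
  have hL : ∀ t : ℝ, 0 < t → ∫ u, Real.exp (-t * u) ∂μ.map (fun x : Ed d => ‖x‖ ^ 2) =
      ∑' k : ℕ, laplaceCoeff d α Λ k * t ^ ((k : ℝ) * (α / 2)) := fun t ht => by
    rw [integral_map hm.aemeasurable (by fun_prop),
      integral_exp_neg_mul_norm_sq_eq_tsum Λ μ hd hα0 hα1 hμ ht]
  rw [map_norm_eq_map_norm_sq_preimage (measure_singleton_zero Λ μ hα0 hΛ hμ) hs,
    measure_inter_Ioi_eq_ofReal_integral hν (half_pos hα0)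
      (fun R hR => summable_laplaceCoeff Λ hd hα0 hα1 hR) hL
      (Real.continuous_sqrt.measurable hs), setIntegral_sqrt_preimage_inter_Ioi _ hs]
  congr 1
  refine setIntegral_congr_fun (hs.inter measurableSet_Ioi) fun r hr => ?_
  rw [tsum_radTerm_eq_ofReal Λ hd hα0 hα1 hr.2, Complex.ofReal_re]

end StablePaper
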